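/- arXiv:2203.08599 — 3 statements merged into one kernel-verified Lean document; each statement's English description precedes it below -/
import Mathlib

section
/- Weighted Hardy-type estimate: let 0 < p < 2 and let u ∈ C¹([0,T]×ℝ³) be such that for each t, |x|^{p/2}|u(t,x)| → 0 as |x| → ∞ and the relevant weighted integrals are finite. Then the space-time norm ‖r^{(p−3)/2} u‖_{L²([0,T]×ℝ³)} plus the uniform-in-time norm sup_{t∈[0,T]} ‖r^{(p−2)/2} u(t,·)‖_{L²(ℝ³)} is bounded by a constant (depending only on p) times ‖r^{(p−2)/2} u(0,·)‖_{L²(ℝ³)} + ‖r^{(p−3)/2} (∂_t + ∂_r)(ru)‖_{L²([0,T]×ℝ³)}. -/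
noncomputable section

open MeasureTheory
open scoped RealInnerProductSpace

abbrev E3 := EuclideanSpace ℝ (Fin 3)

def radD (v : E3 → ℝ) (x : E3) : ℝ := ‖x‖⁻¹ * ⟪x, gradient v x⟫

/-- `(∂_t + ∂_r)(ru)` at `(t,x)`. -/
def goodDru (u : ℝ → E3 → ℝ) (t : ℝ) (x : E3) : ℝ :=
  ‖x‖ * deriv (fun s => u s x) t + radD (fun y => ‖y‖ * u t y) x

lemma polar3 (f : E3 → ENNReal) (hf : Measurable f) :
    ∫⁻ x, f x = ∫⁻ ω : Metric.sphere (0 : E3) 1, (∫⁻ r : ℝ,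
      if 0 < r then ENNReal.ofReal (r ^ 2) * f (r • (ω : E3)) else 0)
        ∂((volume : Measure E3).toSphere) := by
  have hd : Module.finrank ℝ E3 - 1 = 2 := by simp
  have hmp := (volume : Measure E3).measurePreserving_homeomorphUnitSphereProd
  rw [hd] at hmp
  have hc : Measurable (fun z : Metric.sphere (0 : E3) 1 × Set.Ioi (0 : ℝ) =>
      f ((z.2 : ℝ) • (z.1 : E3))) := by
    apply hf.comp
    fun_prop
  calc ∫⁻ x, f x = ∫⁻ x : ({(0 : E3)}ᶜ : Set E3), f x ∂((volume : Measure E3).comap (↑)) := by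
        rw [lintegral_subtype_comap (measurableSet_singleton _).compl, restrict_compl_singleton]
    _ = ∫⁻ z, f ((z.2 : ℝ) • (z.1 : E3)) ∂((volume : Measure E3).toSphere.prod
          (Measure.volumeIoiPow 2)) := by
        rw [← hmp.lintegral_comp hc]
        refine lintegral_congr fun x => ?_
        congr 1
        have hx : ‖(x : E3)‖ ≠ 0 := norm_ne_zero_iff.2 x.2
        simp [smul_smul, hx]
    _ = _ := by
        rw [lintegral_prod _ hc.aemeasurable]
        refine lintegral_congr fun ω => ?_
        have hc' : Measurable (fun r : Set.Ioi (0 : ℝ) => f ((r : ℝ) • (ω : E3))) := by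
          apply hf.comp
          fun_prop
        rw [Measure.volumeIoiPow, lintegral_withDensity_eq_lintegral_mul _ (by fun_prop)
          hc']
        simp only [Pi.mul_apply]
        rw [lintegral_subtype_comap measurableSet_Ioi
          (fun r : ℝ => ENNReal.ofReal (r ^ 2) * f (r • (ω : E3))),
          ← lintegral_indicator measurableSet_Ioi]
        rfl

def WW (k : ℝ) (f : ℝ × ℝ → ℝ) (z : ℝ × ℝ) : ENNReal :=
  if 0 < z.2 then ENNReal.ofReal (z.2 ^ k * f z ^ 2) else 0

lemma WW_meas (k : ℝ) (f : ℝ × ℝ → ℝ) (hf : Continuous f) : Measurable (WW k f) := by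
  have := hf.measurable
  refine Measurable.ite (measurableSet_lt measurable_const measurable_snd) ?_ measurable_const
  fun_prop

lemma WW_int (k : ℝ) (f : ℝ × ℝ → ℝ) (c t a : ℝ) (ha : a = max 0 (-c)) :
    ∫⁻ s in Set.Ioc 0 t, WW k f (s, c + s) =
      ∫⁻ s in Set.Ioc a t, ENNReal.ofReal ((c + s) ^ k * f (s, c + s) ^ 2) := by
  have hm : MeasurableSet {s : ℝ | 0 < c + s} := measurableSet_lt (by fun_prop) (by fun_prop)
  have h1 : (fun s => WW k f (s, c + s)) = Set.indicator {s : ℝ | 0 < c + s}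
      (fun s => ENNReal.ofReal ((c + s) ^ k * f (s, c + s) ^ 2)) := by
    ext s; simp [WW, Set.indicator]
  rw [h1, lintegral_indicator hm, Measure.restrict_restrict hm]
  congr 2
  ext s
  simp only [Set.mem_inter_iff, Set.mem_ofPred_eq, Set.mem_Ioc, ha, max_lt_iff]
  constructor
  · rintro ⟨h, h2, h3⟩; exact ⟨⟨h2, by linarith⟩, h3⟩
  · rintro ⟨⟨h, h2⟩, h3⟩; exact ⟨by linarith, h, h3⟩

lemma char_ineq (p : ℝ) (hp0 : 0 < p) (hp2 : p < 2) (v w : ℝ × ℝ → ℝ) (hv : Continuous v)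
    (hw : Continuous w)
    (hd : ∀ c s : ℝ, HasDerivAt (fun s => v (s, c + s)) (w (s, c + s)) s)
    (t : ℝ) (ht : 0 ≤ t) (c : ℝ) :
    WW p v (t, c + t) + ENNReal.ofReal ((2 - p) / 2) *
        ∫⁻ s in Set.Ioc 0 t, WW (p - 1) v (s, c + s) ≤
      WW p v (0, c) + ENNReal.ofReal (((2 - p) / 2)⁻¹) *
        ∫⁻ s in Set.Ioc 0 t, WW (p - 1) (fun z => z.2 * w z + v z) (s, c + s) := by
  set d := (2 - p) / 2 with hdd
  have hdpos : 0 < d := by rw [hdd]; linarith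
  obtain ⟨a, ha⟩ : ∃ a, a = max 0 (-c) := ⟨_, rfl⟩
  have ha0 : 0 ≤ a := ha ▸ le_max_left _ _
  have hac : -c ≤ a := ha ▸ le_max_right _ _
  rw [WW_int _ _ c t a ha, WW_int _ _ c t a ha]
  rcases le_or_gt (c + t) 0 with hct | hct
  · have : Set.Ioc a t = ∅ := Set.Ioc_eq_empty (by linarith)
    simp [WW, this, hct.not_gt]
  have hat : a ≤ t := by rw [ha]; exact max_le ht (by linarith)
  have hint : ∀ f : ℝ × ℝ → ℝ, Continuous f →
      IntervalIntegrable (fun s => (c + s) ^ (p - 1) * f (s, c + s) ^ 2) volume a t := by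
    intro f hf
    have h1 : IntervalIntegrable (fun s : ℝ => s ^ (p - 1)) volume (c + a) (c + t) :=
      intervalIntegral.intervalIntegrable_rpow' (by linarith)
    have h2 := h1.comp_add_left c
    simp only [add_sub_cancel_left] at h2
    exact h2.mul_continuousOn (by fun_prop)
  set G : ℝ × ℝ → ℝ := fun z => z.2 * w z + v z with hG
  have hGc : Continuous G := by fun_prop
  have hA := hint v hv
  have hB := hint G hGc
  have key := intervalIntegral.sub_le_integral_of_hasDeriv_right_of_le (a := a) (b := t)
    (g := fun s => (c + s) ^ p * v (s, c + s) ^ 2)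
    (g' := fun s => 1 * p * (c + s) ^ (p - 1) * v (s, c + s) ^ 2 +
      (c + s) ^ p * (2 * v (s, c + s) * w (s, c + s)))
    (φ := fun s => d⁻¹ * ((c + s) ^ (p - 1) * G (s, c + s) ^ 2) -
      d * ((c + s) ^ (p - 1) * v (s, c + s) ^ 2)) hat
    (by
      apply Continuous.continuousOn
      have : Continuous fun s : ℝ => (c + s) ^ p :=
        (continuous_const.add continuous_id).rpow_const (fun _ => Or.inr hp0.le)
      fun_prop)
    (by
      intro s hs
      have hr : 0 < c + s := by linarith [hs.1]
      have h1 : HasDerivAt (fun s : ℝ => (c + s) ^ p) (1 * p * (c + s) ^ (p - 1)) s :=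
        ((hasDerivAt_id s).const_add c).rpow_const (Or.inl hr.ne')
      have h2 := (hd c s).pow 2
      refine HasDerivAt.hasDerivWithinAt ((h1.mul h2).congr_deriv ?_)
      simp only [Pi.pow_apply]
      push_cast
      ring)
    (by
      rw [← intervalIntegrable_iff_integrableOn_Icc_of_le hat]
      exact (hB.const_mul _).sub (hA.const_mul _))
    (by
      intro s hs
      have hr : 0 < c + s := by linarith [hs.1]
      have e : (c + s) ^ p = (c + s) ^ (p - 1) * (c + s) := by
        rw [Real.rpow_sub_one hr.ne']; field_simp
      have hq : 0 < (c + s) ^ (p - 1) := Real.rpow_pos_of_pos hr _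
      simp only [hG]
      rw [e]
      generalize (c + s) ^ (p - 1) = q at *
      generalize v (s, c + s) = V
      generalize w (s, c + s) = X
      generalize c + s = r at *
      have h3 : 2 * V * (r * X + V) ≤ d * V ^ 2 + d⁻¹ * (r * X + V) ^ 2 := by
        have : 0 ≤ d⁻¹ * (d * V - (r * X + V)) ^ 2 := by positivity
        have h4 : d⁻¹ * (d * V - (r * X + V)) ^ 2 =
          d * V ^ 2 - 2 * V * (r * X + V) + d⁻¹ * (r * X + V) ^ 2 := by field_simp; ring
        linarith
      have h5 := mul_le_mul_of_nonneg_left h3 hq.le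
      have : p = 2 - 2 * d := by rw [hdd]; ring
      rw [this]
      linarith)
  rw [intervalIntegral.integral_sub (hB.const_mul _) (hA.const_mul _),
    intervalIntegral.integral_const_mul, intervalIntegral.integral_const_mul,
    intervalIntegral.integral_of_le hat, intervalIntegral.integral_of_le hat] at key
  have hnn : ∀ f : ℝ × ℝ → ℝ, 0 ≤ᵐ[volume.restrict (Set.Ioc a t)]
      (fun s => (c + s) ^ (p - 1) * f (s, c + s) ^ 2) := by
    intro f
    filter_upwards [ae_restrict_mem measurableSet_Ioc] with s hs
    have hr : 0 < c + s := by linarith [hs.1]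
    simp only [Pi.zero_apply]
    positivity
  rw [← ofReal_integral_eq_lintegral_ofReal hA.1 (hnn v),
    ← ofReal_integral_eq_lintegral_ofReal hB.1 (hnn G)]
  have hga : WW p v (0, c) = ENNReal.ofReal ((c + a) ^ p * v (a, c + a) ^ 2) := by
    rcases le_or_gt c 0 with h | h
    · have : a = -c := by rw [ha]; exact max_eq_right (by linarith)
      simp [WW, h.not_gt, this, Real.zero_rpow hp0.ne']
    · have : a = 0 := by rw [ha]; exact max_eq_left (by linarith)
      simp [WW, h, this]
  rw [hga]
  have i1 := integral_nonneg_of_ae (hnn v)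
  have i2 := integral_nonneg_of_ae (hnn G)
  have hca : 0 ≤ c + a := by linarith
  simp only [WW, hct, if_true]
  rw [← ENNReal.ofReal_mul hdpos.le, ← ENNReal.ofReal_mul (inv_pos.2 hdpos).le,
    ← ENNReal.ofReal_add (by positivity) (by positivity),
    ← ENNReal.ofReal_add (by positivity) (by positivity)]
  apply ENNReal.ofReal_le_ofReal
  linarith

lemma shift_swap (h : ℝ × ℝ → ENNReal) (hh : Measurable h) (t : ℝ) :
    ∫⁻ c, ∫⁻ s in Set.Ioc 0 t, h (s, c + s) = ∫⁻ s in Set.Ioc 0 t, ∫⁻ r, h (s, r) := by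
  rw [lintegral_lintegral_swap]
  · refine lintegral_congr fun s => ?_
    exact lintegral_add_right_eq_self (fun r => h (s, r)) s
  · apply Measurable.aemeasurable
    apply hh.comp
    fun_prop

lemma plane_ineq (p : ℝ) (hp0 : 0 < p) (hp2 : p < 2) (v w : ℝ × ℝ → ℝ) (hv : Continuous v)
    (hw : Continuous w)
    (hd : ∀ c s : ℝ, HasDerivAt (fun s => v (s, c + s)) (w (s, c + s)) s)
    (t : ℝ) (ht : 0 ≤ t) :
    (∫⁻ r, WW p v (t, r)) + ENNReal.ofReal ((2 - p) / 2) *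
        ∫⁻ s in Set.Ioc 0 t, ∫⁻ r, WW (p - 1) v (s, r) ≤
      (∫⁻ r, WW p v (0, r)) + ENNReal.ofReal (((2 - p) / 2)⁻¹) *
        ∫⁻ s in Set.Ioc 0 t, ∫⁻ r, WW (p - 1) (fun z => z.2 * w z + v z) (s, r) := by
  have hG : Continuous (fun z : ℝ × ℝ => z.2 * w z + v z) := by fun_prop
  have m1 := WW_meas p v hv
  have m2 := WW_meas (p - 1) v hv
  have m3 := WW_meas (p - 1) _ hG
  rw [← shift_swap _ m2, ← shift_swap _ m3,
    ← lintegral_add_right_eq_self (fun r => WW p v (t, r)) t,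
    ← lintegral_const_mul' _ _ ENNReal.ofReal_ne_top,
    ← lintegral_const_mul' _ _ ENNReal.ofReal_ne_top,
    ← lintegral_add_left (by exact m1.comp (by fun_prop)),
    ← lintegral_add_left (by exact m1.comp (by fun_prop))]
  exact lintegral_mono fun c => char_ineq p hp0 hp2 v w hv hw hd t ht c

lemma polarWW (k : ℝ) (F : E3 → ℝ) (hF : Measurable F) (s : ℝ)
    (f : Metric.sphere (0 : E3) 1 → ℝ × ℝ → ℝ)
    (hf : ∀ (ω : Metric.sphere (0 : E3) 1) (r : ℝ), 0 < r → F (r • (ω : E3)) = f ω (s, r)) :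
    ∫⁻ x, ENNReal.ofReal (‖x‖ ^ (k - 2) * F x ^ 2) =
      ∫⁻ ω, ∫⁻ r, WW k (f ω) (s, r) ∂volume ∂((volume : Measure E3).toSphere) := by
  rw [polar3 _ (by fun_prop)]
  refine lintegral_congr fun ω => lintegral_congr fun r => ?_
  simp only [WW]
  split_ifs with hr
  · have hω : ‖(ω : E3)‖ = 1 := by simp
    rw [← ENNReal.ofReal_mul (by positivity), hf ω r hr, norm_smul, hω, mul_one,
      Real.norm_of_nonneg hr.le, ← mul_assoc]
    congr 2
    rw [Real.rpow_sub hr, Real.rpow_two]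
    field_simp
  · rfl

lemma meas_WW2 (k : ℝ) (f : Metric.sphere (0 : E3) 1 → ℝ × ℝ → ℝ)
    (hf : Continuous (Function.uncurry f)) :
    Measurable (fun z : Metric.sphere (0 : E3) 1 × ℝ => ∫⁻ r, WW k (f z.1) (z.2, r)) := by
  have h : Measurable (fun q : (Metric.sphere (0 : E3) 1 × ℝ) × ℝ =>
      WW k (f q.1.1) (q.1.2, q.2)) := by
    have h1 : Measurable (fun q : (Metric.sphere (0 : E3) 1 × ℝ) × ℝ => f q.1.1 (q.1.2, q.2)) := by
      have : Continuous (fun q : (Metric.sphere (0 : E3) 1 × ℝ) × ℝ =>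
        Function.uncurry f (q.1.1, (q.1.2, q.2))) := by fun_prop
      exact this.measurable
    refine Measurable.ite (measurableSet_lt measurable_const measurable_snd) ?_ measurable_const
    fun_prop
  exact h.lintegral_prod_right'

def GG (u : ℝ → E3 → ℝ) (t : ℝ) (x : E3) : ℝ :=
  ‖x‖ * fderiv ℝ (Function.uncurry u) (t, x) (1, ‖x‖⁻¹ • x) + u t x

lemma GG_meas (u : ℝ → E3 → ℝ) (hu : ContDiff ℝ 1 (Function.uncurry u)) :
    Measurable (Function.uncurry (GG u)) := by
  have h1 : Measurable (fun q : ℝ × E3 => fderiv ℝ (Function.uncurry u) q) :=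
    (hu.continuous_fderiv (by norm_num)).measurable
  have h2 : Measurable (fun q : ℝ × E3 => ((1 : ℝ), ‖q.2‖⁻¹ • q.2)) := by fun_prop
  have h3 : Measurable (fun q : ℝ × E3 =>
      fderiv ℝ (Function.uncurry u) q ((1 : ℝ), ‖q.2‖⁻¹ • q.2)) := by
    have hc : Continuous (fun z : ((ℝ × E3) →L[ℝ] ℝ) × (ℝ × E3) => z.1 z.2) := by fun_prop
    exact hc.measurable.comp (h1.prodMk h2)
  have h4 : Measurable (fun q : ℝ × E3 => u q.1 q.2) := hu.continuous.measurable
  exact (measurable_snd.norm.mul h3).add h4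

lemma GG_meas' (u : ℝ → E3 → ℝ) (hu : ContDiff ℝ 1 (Function.uncurry u)) (s : ℝ) :
    Measurable (GG u s) := by
  have h : Measurable (fun x : E3 => (s, x)) := measurable_prodMk_left
  have := (GG_meas u hu).comp h
  exact this

lemma goodDru_eq (u : ℝ → E3 → ℝ) (hu : ContDiff ℝ 1 (Function.uncurry u)) (t : ℝ) (x : E3)
    (hx : x ≠ 0) : goodDru u t x = GG u t x := by
  have hU : HasFDerivAt (Function.uncurry u) (fderiv ℝ (Function.uncurry u) (t, x)) (t, x) :=
    (hu.differentiable (by norm_num) _).hasFDerivAt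
  set L := fderiv ℝ (Function.uncurry u) (t, x) with hL
  have hn : ‖x‖ ≠ 0 := norm_ne_zero_iff.2 hx
  have h1 : HasDerivAt (fun s => u s x) (L (1, 0)) t := by
    have := hU.comp_hasDerivAt t ((hasDerivAt_id t).prodMk (hasDerivAt_const t x))
    exact this
  have h2 : HasFDerivAt (u t) (L.comp (ContinuousLinearMap.inr ℝ ℝ E3)) x := by
    have := hU.comp x (hasFDerivAt_prodMk_right t x)
    exact this
  have hnd : DifferentiableAt ℝ (fun y : E3 => ‖y‖) x := (contDiffAt_norm ℝ hx).differentiableAt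
    (by norm_num : (1 : WithTop ℕ∞) ≠ 0)
  have h3 := hnd.hasFDerivAt.mul h2
  have h4 : fderiv ℝ (fun y : E3 => ‖y‖) x x = ‖x‖ := by
    have := hnd.fderiv_norm_self
    exact this
  have h5 : ⟪x, gradient (fun y => ‖y‖ * u t y) x⟫ = ‖x‖ * L (0, x) + u t x * ‖x‖ := by
    rw [real_inner_comm, gradient, InnerProductSpace.toDual_symm_apply]
    have := h3.fderiv
    erw [this]
    simp [h4]
  have h6 : L (1, ‖x‖⁻¹ • x) = L (1, 0) + ‖x‖⁻¹ * L (0, x) := by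
    have : ((1 : ℝ), ‖x‖⁻¹ • x) = (1, 0) + ‖x‖⁻¹ • ((0 : ℝ), x) := by simp
    rw [this, map_add, map_smul, smul_eq_mul]
  rw [goodDru, radD, GG, h1.deriv, h5, ← hL, h6]
  field_simp
  ring

set_option maxHeartbeats 800000 in
lemma energy (p : ℝ) (hp0 : 0 < p) (hp2 : p < 2) (u : ℝ → E3 → ℝ)
    (hu : ContDiff ℝ 1 (Function.uncurry u)) (t : ℝ) (ht : 0 ≤ t) :
    (∫⁻ x, ENNReal.ofReal (‖x‖ ^ (p - 2) * u t x ^ 2)) + ENNReal.ofReal ((2 - p) / 2) *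
        ∫⁻ s in Set.Ioc 0 t, ∫⁻ x, ENNReal.ofReal (‖x‖ ^ (p - 3) * u s x ^ 2) ≤
      (∫⁻ x, ENNReal.ofReal (‖x‖ ^ (p - 2) * u 0 x ^ 2)) +
        ENNReal.ofReal (((2 - p) / 2)⁻¹) *
        ∫⁻ s in Set.Ioc 0 t, ∫⁻ x, ENNReal.ofReal (‖x‖ ^ (p - 3) * goodDru u s x ^ 2) := by
  set v : Metric.sphere (0 : E3) 1 → ℝ × ℝ → ℝ := fun ω z => u z.1 (z.2 • (ω : E3)) with hvdef
  set w : Metric.sphere (0 : E3) 1 → ℝ × ℝ → ℝ := fun ω z =>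
    fderiv ℝ (Function.uncurry u) (z.1, z.2 • (ω : E3)) (1, (ω : E3)) with hwdef
  have hv : Continuous (Function.uncurry v) := by
    have h : Continuous (fun q : Metric.sphere (0 : E3) 1 × (ℝ × ℝ) =>
      (q.2.1, q.2.2 • (q.1 : E3))) := by fun_prop
    exact hu.continuous.comp h
  have hw : Continuous (Function.uncurry w) := by
    have h : Continuous (fun q : Metric.sphere (0 : E3) 1 × (ℝ × ℝ) =>
      (q.2.1, q.2.2 • (q.1 : E3))) := by fun_prop
    have h2 : Continuous (fun q : Metric.sphere (0 : E3) 1 × (ℝ × ℝ) =>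
      ((1 : ℝ), (q.1 : E3))) := by fun_prop
    exact ((hu.continuous_fderiv (by norm_num)).comp h).clm_apply h2
  set G : Metric.sphere (0 : E3) 1 → ℝ × ℝ → ℝ := fun ω z => z.2 * w ω z + v ω z with hGdef
  have hG : Continuous (Function.uncurry G) := by
    have h : Continuous (fun q : Metric.sphere (0 : E3) 1 × (ℝ × ℝ) => q.2.2) := by fun_prop
    exact (h.mul hw).add hv
  have hum : ∀ s, Measurable (u s) := fun s =>
    (hu.continuous.comp (by fun_prop : Continuous (fun x : E3 => (s, x)))).measurable
  have e2 : ∀ s, ∫⁻ x, ENNReal.ofReal (‖x‖ ^ (p - 2) * u s x ^ 2) =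
      ∫⁻ ω, ∫⁻ r, WW p (v ω) (s, r) ∂volume ∂((volume : Measure E3).toSphere) := fun s =>
    polarWW p (u s) (hum s) s v (fun ω r _ => rfl)
  have hp3 : p - 3 = p - 1 - 2 := by ring
  have e3 : ∀ s, ∫⁻ x, ENNReal.ofReal (‖x‖ ^ (p - 3) * u s x ^ 2) =
      ∫⁻ ω, ∫⁻ r, WW (p - 1) (v ω) (s, r) ∂volume ∂((volume : Measure E3).toSphere) := fun s => by
    rw [hp3]
    exact polarWW (p - 1) (u s) (hum s) s v (fun ω r _ => rfl)
  have e4 : ∀ s, ∫⁻ x, ENNReal.ofReal (‖x‖ ^ (p - 3) * goodDru u s x ^ 2) =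
      ∫⁻ ω, ∫⁻ r, WW (p - 1) (G ω) (s, r) ∂volume ∂((volume : Measure E3).toSphere) := fun s => by
    rw [hp3, ← polarWW (p - 1) (GG u s) (GG_meas' u hu s) s G ?_]
    · refine lintegral_congr_ae ?_
      have : ∀ᵐ x : E3, x ≠ 0 := by simp [ae_iff]
      filter_upwards [this] with x hx
      rw [goodDru_eq u hu s x hx]
    · intro ω r hr
      have hω : ‖(ω : E3)‖ = 1 := by simp
      have : (r⁻¹ * r) = 1 := inv_mul_cancel₀ hr.ne'
      simp only [GG, G, w, v, norm_smul, hω, mul_one, Real.norm_of_nonneg hr.le, smul_smul, this,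
        one_smul]
  have swap : ∀ f : Metric.sphere (0 : E3) 1 → ℝ × ℝ → ℝ, Continuous (Function.uncurry f) →
      ∫⁻ s in Set.Ioc 0 t, ∫⁻ ω, ∫⁻ r, WW (p - 1) (f ω) (s, r) ∂volume
        ∂((volume : Measure E3).toSphere) =
      ∫⁻ ω, (∫⁻ s in Set.Ioc 0 t, ∫⁻ r, WW (p - 1) (f ω) (s, r))
        ∂((volume : Measure E3).toSphere) := by
    intro f hf
    rw [lintegral_lintegral_swap]
    exact ((meas_WW2 (p - 1) f hf).comp measurable_swap).aemeasurable
  have m1 : ∀ s, Measurable (fun ω => ∫⁻ r, WW p (v ω) (s, r)) := fun s =>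
    (meas_WW2 p v hv).comp (measurable_prodMk_right (y := s))
  simp only [e2, e3, e4]
  rw [swap v hv, swap G hG,
    ← lintegral_const_mul' _ _ ENNReal.ofReal_ne_top,
    ← lintegral_const_mul' _ _ ENNReal.ofReal_ne_top,
    ← lintegral_add_left (m1 t), ← lintegral_add_left (m1 0)]
  refine lintegral_mono fun ω => plane_ineq p hp0 hp2 (v ω) (w ω) ?_ ?_ ?_ t ht
  · exact hv.comp (by fun_prop : Continuous (fun z : ℝ × ℝ => (ω, z)))
  · exact hw.comp (by fun_prop : Continuous (fun z : ℝ × ℝ => (ω, z)))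
  · intro c s
    have hU : HasFDerivAt (Function.uncurry u)
        (fderiv ℝ (Function.uncurry u) (s, (c + s) • (ω : E3))) (s, (c + s) • (ω : E3)) :=
      (hu.differentiable (by norm_num) _).hasFDerivAt
    have h1 : HasDerivAt (fun s : ℝ => (c + s) • (ω : E3)) ((1 : ℝ) • (ω : E3)) s :=
      ((hasDerivAt_id s).const_add c).smul_const _
    rw [one_smul] at h1
    exact hU.comp_hasDerivAt s ((hasDerivAt_id s).prodMk h1)

/-- Weighted Hardy-type estimate: for `0 < p < 2`,
`‖r^{(p−3)/2}u‖_{L²L²} + sup_t ‖r^{(p−2)/2}u(t)‖_{L²} ≲_p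
  ‖r^{(p−2)/2}u(0)‖_{L²} + ‖r^{(p−3)/2}(∂_t+∂_r)(ru)‖_{L²L²}`. -/
theorem weighted_hardy (p : ℝ) (hp0 : 0 < p) (hp2 : p < 2) :
    ∃ C > 0, ∀ T : ℝ, 0 ≤ T → ∀ u : ℝ → E3 → ℝ,
      ContDiff ℝ 1 (Function.uncurry u) →
      (∀ t ∈ Set.Icc (0 : ℝ) T,
        Filter.Tendsto (fun x : E3 => ‖x‖ ^ (p / 2) * |u t x|)
          (Filter.comap (fun x : E3 => ‖x‖) Filter.atTop) (nhds 0)) →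
      IntegrableOn (fun q : ℝ × E3 => ‖q.2‖ ^ (p - 3) * (u q.1 q.2) ^ 2)
        (Set.Ioc 0 T ×ˢ Set.univ) →
      IntegrableOn (fun q : ℝ × E3 => ‖q.2‖ ^ (p - 3) * (goodDru u q.1 q.2) ^ 2)
        (Set.Ioc 0 T ×ˢ Set.univ) →
      (∀ t ∈ Set.Icc (0 : ℝ) T,
        Integrable (fun x : E3 => ‖x‖ ^ (p - 2) * (u t x) ^ 2)) →
      Real.sqrt (∫ t in Set.Ioc (0 : ℝ) T, ∫ x : E3, ‖x‖ ^ (p - 3) * (u t x) ^ 2) +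
          ⨆ t ∈ Set.Icc (0 : ℝ) T,
            Real.sqrt (∫ x : E3, ‖x‖ ^ (p - 2) * (u t x) ^ 2)
        ≤ C * (Real.sqrt (∫ x : E3, ‖x‖ ^ (p - 2) * (u 0 x) ^ 2) +
            Real.sqrt (∫ t in Set.Ioc (0 : ℝ) T,
              ∫ x : E3, ‖x‖ ^ (p - 3) * (goodDru u t x) ^ 2)) := by
  have hd : 0 < (2 - p) / 2 := by linarith
  obtain ⟨d, hdd⟩ : ∃ d, d = (2 - p) / 2 := ⟨_, rfl⟩
  rw [← hdd] at hd
  refine ⟨(Real.sqrt d⁻¹ + 1) * (1 + Real.sqrt d⁻¹), by positivity, ?_⟩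
  intro T hT u hu _ hY hZ hX
  have hX' : ∀ t ∈ Set.Icc (0 : ℝ) T, ∫⁻ x, ENNReal.ofReal (‖x‖ ^ (p - 2) * u t x ^ 2) =
      ENNReal.ofReal (∫ x : E3, ‖x‖ ^ (p - 2) * (u t x) ^ 2) := fun t ht =>
    (ofReal_integral_eq_lintegral_ofReal (hX t ht)
      (Filter.Eventually.of_forall fun x => by positivity)).symm
  have hconv : ∀ F : ℝ → E3 → ℝ, IntegrableOn (fun q : ℝ × E3 => ‖q.2‖ ^ (p - 3) * (F q.1 q.2) ^ 2)
        (Set.Ioc 0 T ×ˢ Set.univ) →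
      ∫⁻ s in Set.Ioc 0 T, ∫⁻ x, ENNReal.ofReal (‖x‖ ^ (p - 3) * F s x ^ 2) =
        ENNReal.ofReal (∫ t in Set.Ioc (0 : ℝ) T, ∫ x : E3, ‖x‖ ^ (p - 3) * (F t x) ^ 2) := by
    intro F hF
    rw [IntegrableOn, Measure.volume_eq_prod, ← Measure.prod_restrict, Measure.restrict_univ] at hF
    rw [← integral_prod _ hF, ofReal_integral_eq_lintegral_ofReal hF
      (Filter.Eventually.of_forall fun x => by positivity),
      lintegral_prod _ hF.aestronglyMeasurable.aemeasurable.ennreal_ofReal]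
  have hYc := hconv u hY
  have hZc := hconv (goodDru u) hZ
  set Y := ∫ t in Set.Ioc (0 : ℝ) T, ∫ x : E3, ‖x‖ ^ (p - 3) * (u t x) ^ 2 with hYdef
  set Z := ∫ t in Set.Ioc (0 : ℝ) T, ∫ x : E3, ‖x‖ ^ (p - 3) * (goodDru u t x) ^ 2 with hZdef
  have hY0 : 0 ≤ Y := integral_nonneg fun t => integral_nonneg fun x => by positivity
  have hZ0 : 0 ≤ Z := integral_nonneg fun t => integral_nonneg fun x => by positivity
  have hXn : ∀ t, 0 ≤ ∫ x : E3, ‖x‖ ^ (p - 2) * (u t x) ^ 2 := fun t =>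
    integral_nonneg fun x => by positivity
  have h0m : (0 : ℝ) ∈ Set.Icc (0 : ℝ) T := ⟨le_rfl, hT⟩
  have hdi : 0 < d⁻¹ := inv_pos.2 hd
  have rhs : ∀ t ∈ Set.Icc (0 : ℝ) T, (∫⁻ x, ENNReal.ofReal (‖x‖ ^ (p - 2) * u 0 x ^ 2)) +
        ENNReal.ofReal (d⁻¹) *
        ∫⁻ s in Set.Ioc 0 t, ∫⁻ x, ENNReal.ofReal (‖x‖ ^ (p - 3) * goodDru u s x ^ 2) ≤
      ENNReal.ofReal ((∫ x : E3, ‖x‖ ^ (p - 2) * (u 0 x) ^ 2) + d⁻¹ * Z) := by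
    intro t ht
    rw [ENNReal.ofReal_add (hXn 0) (by positivity), ENNReal.ofReal_mul hdi.le, ← hZc, hX' 0 h0m]
    gcongr
    exact ht.2
  have hXt : ∀ t ∈ Set.Icc (0 : ℝ) T, (∫ x : E3, ‖x‖ ^ (p - 2) * (u t x) ^ 2) ≤
      (∫ x : E3, ‖x‖ ^ (p - 2) * (u 0 x) ^ 2) + d⁻¹ * Z := by
    intro t ht
    have h := energy p hp0 hp2 u hu t ht.1
    rw [← hdd] at h
    have h2 := (le_self_add.trans h).trans (rhs t ht)
    rw [hX' t ht] at h2
    have := hXn 0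
    exact (ENNReal.ofReal_le_ofReal_iff (by positivity)).1 h2
  have hYb : d * Y ≤ (∫ x : E3, ‖x‖ ^ (p - 2) * (u 0 x) ^ 2) + d⁻¹ * Z := by
    have h := energy p hp0 hp2 u hu T hT
    rw [← hdd] at h
    have h2 := (le_add_self.trans h).trans (rhs T ⟨hT, le_rfl⟩)
    rw [hYc, ← ENNReal.ofReal_mul hd.le] at h2
    have := hXn 0
    exact (ENNReal.ofReal_le_ofReal_iff (by positivity)).1 h2
  have hx0 := hXn 0
  set X0 := ∫ x : E3, ‖x‖ ^ (p - 2) * (u 0 x) ^ 2 with hX0def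
  have hS : Real.sqrt (X0 + d⁻¹ * Z) ≤ (1 + Real.sqrt d⁻¹) * (Real.sqrt X0 + Real.sqrt Z) := by
    have h1 : Real.sqrt (X0 + d⁻¹ * Z) ≤ Real.sqrt X0 + Real.sqrt d⁻¹ * Real.sqrt Z := by
      rw [← Real.sqrt_mul hdi.le]
      have hz : 0 ≤ d⁻¹ * Z := by positivity
      apply Real.sqrt_le_iff.2
      refine ⟨by positivity, ?_⟩
      have e1 := Real.sq_sqrt hx0
      have e2 := Real.sq_sqrt hz
      nlinarith [mul_nonneg (Real.sqrt_nonneg X0) (Real.sqrt_nonneg (d⁻¹ * Z))]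
    have := Real.sqrt_nonneg X0
    have := Real.sqrt_nonneg Z
    have := Real.sqrt_nonneg d⁻¹
    nlinarith [mul_nonneg (Real.sqrt_nonneg d⁻¹) (Real.sqrt_nonneg X0)]
  have hYs : Real.sqrt Y ≤ Real.sqrt d⁻¹ * Real.sqrt (X0 + d⁻¹ * Z) := by
    rw [← Real.sqrt_mul hdi.le]
    apply Real.sqrt_le_sqrt
    rw [le_inv_mul_iff₀ hd]
    exact hYb
  have hsup : (⨆ t ∈ Set.Icc (0 : ℝ) T,
      Real.sqrt (∫ x : E3, ‖x‖ ^ (p - 2) * (u t x) ^ 2)) ≤ Real.sqrt (X0 + d⁻¹ * Z) :=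
    Real.iSup_le (fun t => Real.iSup_le (fun ht => Real.sqrt_le_sqrt (hXt t ht))
      (Real.sqrt_nonneg _)) (Real.sqrt_nonneg _)
  calc _ ≤ Real.sqrt d⁻¹ * Real.sqrt (X0 + d⁻¹ * Z) + Real.sqrt (X0 + d⁻¹ * Z) :=
        add_le_add hYs hsup
    _ = (Real.sqrt d⁻¹ + 1) * Real.sqrt (X0 + d⁻¹ * Z) := by ring
    _ ≤ (Real.sqrt d⁻¹ + 1) * ((1 + Real.sqrt d⁻¹) * (Real.sqrt X0 + Real.sqrt Z)) :=
        mul_le_mul_of_nonneg_left hS (by positivity)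
    _ = _ := by ring
end
end

section
/- Hardy inequality with decay in t−r: for any fixed t ≥ 0 and any u ∈ C¹(ℝ³) supported in {|x| ≤ t+2} with u decaying suitably, ∫_{ℝ³} u(x)²/((1+|x|)(t−|x|+3)²) dx ≤ C ( ∫_{ℝ³} u(x)²/((1+|x|)|x|²) dx + ∫_{ℝ³} (∂_r u(x))²/(1+|x|) dx ) for a universal constant C independent of t and u. -/
noncomputable section

open MeasureTheory
open scoped RealInnerProductSpace

lemma polar_nonpos (g : E3 → ℝ)
    (h : ∀ w : E3, ‖w‖ = 1 → ∫ r in Set.Ioi (0:ℝ), r ^ 2 * g (r • w) ≤ 0) :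
    ∫ x, g x ≤ 0 := by
  have e1 : ∫ x, g x = ∫ x : ({(0)}ᶜ : Set E3), g x.1 ∂(Measure.comap (↑) (volume : Measure E3)) := by
    rw [integral_subtype_comap (measurableSet_singleton _).compl g,
        restrict_compl_singleton]
  have e2 := (volume : Measure E3).measurePreserving_homeomorphUnitSphereProd.integral_comp
        (Homeomorph.measurableEmbedding _) (fun p => g (p.2.1 • p.1.1))
  have e3 : ∫ x : ({(0)}ᶜ : Set E3), g x.1 ∂(Measure.comap (↑) (volume : Measure E3))
     = ∫ x : ({(0)}ᶜ : Set E3), (fun p : Metric.sphere (0:E3) 1 × Set.Ioi (0:ℝ) => g (p.2.1 • p.1.1))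
        (homeomorphUnitSphereProd E3 x) ∂(Measure.comap (↑) (volume : Measure E3)) := by
    apply integral_congr_ae
    refine .of_forall fun x => ?_
    have hx : ‖x.1‖ ≠ 0 := norm_ne_zero_iff.2 x.2
    simp [smul_smul, hx]
  rw [e1, e3, e2]
  by_cases hi : Integrable (fun p : Metric.sphere (0:E3) 1 × Set.Ioi (0:ℝ) => g (p.2.1 • p.1.1))
      ((volume : Measure E3).toSphere.prod (.volumeIoiPow (Module.finrank ℝ E3 - 1)))
  swap
  · rw [integral_undef hi]
  rw [integral_prod _ hi]
  apply integral_nonpos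
  intro w
  have hw : ‖w.1‖ = 1 := by simpa using w.2
  have := h w.1 hw
  have e4 : Module.finrank ℝ E3 - 1 = 2 := by simp
  simp only [e4, Measure.volumeIoiPow, ENNReal.ofReal, Pi.zero_apply]
  rw [integral_withDensity_eq_integral_smul,
    integral_subtype_comap measurableSet_Ioi fun a ↦ Real.toNNReal (a ^ 2) • g (a • w.1),
    setIntegral_congr_fun measurableSet_Ioi (g := fun r => r ^ 2 * g (r • w.1)) fun x hx ↦ ?_]
  · exact this
  · simp only [NNReal.smul_def]
    rw [Real.coe_toNNReal _ (by positivity), smul_eq_mul]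
  · exact (measurable_subtype_coe.pow_const _).real_toNNReal

lemma oneD (t : ℝ) (ht : 0 ≤ t) (f f' : ℝ → ℝ) (hf : ∀ r, HasDerivAt f (f' r) r)
    (hc : Continuous f') (h0 : ∀ r, t + 2 < r → f r = 0) (h0' : ∀ r, t + 2 < r → f' r = 0) :
    ∫ r in Set.Ioi (0:ℝ), r ^ 2 * (1 / 2 * (f r ^ 2 / ((1 + r) * (t - r + 3) ^ 2))
      - 2 * (f' r ^ 2 / (1 + r))) ≤ 0 := by
  have hfc : Continuous f := continuous_iff_continuousAt.2 fun r => (hf r).continuousAt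
  have hR : (0:ℝ) ≤ t + 5 / 2 := by linarith
  have e1 : ∫ r in Set.Ioi (0:ℝ), r ^ 2 * (1 / 2 * (f r ^ 2 / ((1 + r) * (t - r + 3) ^ 2))
      - 2 * (f' r ^ 2 / (1 + r))) = ∫ r in (0:ℝ)..(t + 5 / 2),
      r ^ 2 * (1 / 2 * (f r ^ 2 / ((1 + r) * (t - r + 3) ^ 2))
      - 2 * (f' r ^ 2 / (1 + r))) := by
    rw [intervalIntegral.integral_of_le hR]
    apply setIntegral_eq_of_subset_of_forall_sdiff_eq_zero measurableSet_Ioi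
    · intro x hx; exact hx.1
    · intro x hx
      have : t + 2 < x := by
        by_contra hh
        exact hx.2 ⟨hx.1, by linarith⟩
      simp [h0 x this, h0' x this]
  rw [e1]
  set F : ℝ → ℝ := fun r => r ^ 2 * f r ^ 2 / ((1 + r) * (t - r + 3)) with hF
  set F' : ℝ → ℝ := fun r => ((2 * r * f r ^ 2 + r ^ 2 * (2 * f r * f' r)) * ((1 + r) * (t - r + 3))
     - r ^ 2 * f r ^ 2 * ((t - r + 3) - (1 + r))) / ((1 + r) * (t - r + 3)) ^ 2 with hF'
  have hpos : ∀ r ∈ Set.Icc (0:ℝ) (t + 5 / 2), 0 < 1 + r ∧ 0 < t - r + 3 := by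
    intro r hr
    constructor <;> linarith [hr.1, hr.2]
  have hder : ∀ r ∈ Set.uIcc (0:ℝ) (t + 5 / 2), HasDerivAt F (F' r) r := by
    intro r hr
    rw [Set.uIcc_of_le hR] at hr
    obtain ⟨h1, h2⟩ := hpos r hr
    have hn := ((hasDerivAt_id r).pow 2).mul ((hf r).pow 2)
    have hd := ((hasDerivAt_id r).const_add 1).mul ((((hasDerivAt_id r).const_sub t)).add_const 3)
    have := hn.div hd (by simp; constructor <;> positivity)
    refine this.congr_deriv ?_
    simp [hF']
    ring
  have hF'c : ContinuousOn F' (Set.uIcc (0:ℝ) (t + 5 / 2)) := by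
    rw [Set.uIcc_of_le hR]
    apply ContinuousOn.div
    · fun_prop
    · fun_prop
    · intro r hr
      obtain ⟨h1, h2⟩ := hpos r hr
      positivity
  have hgc : ContinuousOn (fun r => r ^ 2 * (1 / 2 * (f r ^ 2 / ((1 + r) * (t - r + 3) ^ 2))
      - 2 * (f' r ^ 2 / (1 + r)))) (Set.uIcc (0:ℝ) (t + 5 / 2)) := by
    rw [Set.uIcc_of_le hR]
    have a : ContinuousOn (fun r => f r ^ 2 / ((1 + r) * (t - r + 3) ^ 2)) (Set.Icc (0:ℝ) (t + 5 / 2)) := by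
      apply ContinuousOn.div
      · fun_prop
      · fun_prop
      · intro r hr
        obtain ⟨h1, h2⟩ := hpos r hr
        positivity
    have b : ContinuousOn (fun r => f' r ^ 2 / (1 + r)) (Set.Icc (0:ℝ) (t + 5 / 2)) := by
      apply ContinuousOn.div
      · fun_prop
      · fun_prop
      · intro r hr
        obtain ⟨h1, h2⟩ := hpos r hr
        positivity
    fun_prop
  have key := intervalIntegral.integral_eq_sub_of_hasDerivAt hder hF'c.intervalIntegrable
  have z1 : F (t + 5 / 2) = 0 := by simp [hF, h0 (t + 5 / 2) (by linarith)]
  have z0 : F 0 = 0 := by simp [hF]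
  rw [z1, z0, sub_zero] at key
  refine le_trans ?_ key.le
  apply intervalIntegral.integral_mono_on hR hgc.intervalIntegrable hF'c.intervalIntegrable
  intro r hr
  obtain ⟨h1, h2⟩ := hpos r hr
  rw [← sub_nonneg]
  have : F' r - r ^ 2 * (1 / 2 * (f r ^ 2 / ((1 + r) * (t - r + 3) ^ 2))
      - 2 * (f' r ^ 2 / (1 + r))) =
      r ^ 2 / (2 * (1 + r)) * (f r / (t - r + 3) + 2 * f' r) ^ 2
       + (r ^ 2 + 2 * r) * f r ^ 2 / ((1 + r) ^ 2 * (t - r + 3)) := by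
    simp only [hF']
    field_simp
    ring
  rw [this]
  have := hr.1
  positivity

/-- Hardy inequality with decay in `t − r`, uniform in `t ≥ 0`, for `u` supported in
`{|x| ≤ t + 2}`. -/
theorem hardy_t_minus_r :
    ∃ C > 0, ∀ t : ℝ, 0 ≤ t → ∀ u : E3 → ℝ, ContDiff ℝ 1 u →
      (∀ x : E3, u x ≠ 0 → ‖x‖ ≤ t + 2) →
      (∫ x : E3, (u x) ^ 2 / ((1 + ‖x‖) * (t - ‖x‖ + 3) ^ 2))
        ≤ C * ((∫ x : E3, (u x) ^ 2 / ((1 + ‖x‖) * ‖x‖ ^ 2)) +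
            ∫ x : E3, (radD u x) ^ 2 / (1 + ‖x‖)) := by
  refine ⟨4, by norm_num, fun t ht u hu hs => ?_⟩
  have hu0 : ∀ x : E3, t + 2 < ‖x‖ → u x = 0 := fun x hx => by
    by_contra h
    exact absurd (hs x h) (not_le.2 hx)
  have hgrad : gradient u = fun x => (InnerProductSpace.toDual ℝ E3).symm (fderiv ℝ u x) := rfl
  have hgc : Continuous (gradient u) := by
    rw [hgrad]
    exact (LinearIsometryEquiv.continuous _).comp (hu.continuous_fderiv (by norm_num))
  have hg0 : ∀ x : E3, t + 2 < ‖x‖ → gradient u x = 0 := fun x hx => by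
    have : u =ᶠ[nhds x] fun _ => 0 := by
      filter_upwards [(isOpen_lt continuous_const continuous_norm).mem_nhds hx] with y hy
      exact hu0 y hy
    have h2 : fderiv ℝ u x = 0 := by
      rw [this.fderiv_eq]; simp
    simp [hgrad, h2]
  have iA : Integrable (fun x : E3 => (u x) ^ 2 / ((1 + ‖x‖) * (t - ‖x‖ + 3) ^ 2)) := by
    have : (fun x : E3 => (u x) ^ 2 / ((1 + ‖x‖) * (t - ‖x‖ + 3) ^ 2)) =
        fun x : E3 => (u x) ^ 2 / ((1 + ‖x‖) * (max 1 (t - ‖x‖ + 3)) ^ 2) := by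
      funext x
      by_cases h : u x = 0
      · simp [h]
      · rw [max_eq_right]
        linarith [hs x h]
    rw [this]
    apply Continuous.integrable_of_hasCompactSupport
    · have := hu.continuous
      apply Continuous.div
      · fun_prop
      · fun_prop
      · intro x
        have : 0 < max 1 (t - ‖x‖ + 3) := lt_max_of_lt_left one_pos
        positivity
    · apply HasCompactSupport.of_support_subset_isCompact (isCompact_closedBall (0:E3) (t + 2))
      intro x hx
      simp only [Metric.mem_closedBall, dist_zero_right]
      apply hs
      rintro h
      simp [h] at hx
  have iG : Integrable (fun x : E3 => ‖gradient u x‖ ^ 2) := by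
    apply Continuous.integrable_of_hasCompactSupport
    · fun_prop
    · apply HasCompactSupport.of_support_subset_isCompact (isCompact_closedBall (0:E3) (t + 2))
      intro x hx
      simp only [Metric.mem_closedBall, dist_zero_right]
      by_contra h
      simp [hg0 x (not_le.1 h)] at hx
  have iB : Integrable (fun x : E3 => (radD u x) ^ 2 / (1 + ‖x‖)) := by
    apply iG.mono'
    · apply Measurable.aestronglyMeasurable
      unfold radD
      have := hgc.measurable
      fun_prop
    · refine .of_forall fun x => ?_
      have h1 : |radD u x| ≤ ‖gradient u x‖ := by
        unfold radD
        rw [abs_mul, abs_inv, abs_norm]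
        rcases eq_or_ne x 0 with rfl | hx
        · simp
        · have hx' : 0 < ‖x‖ := norm_pos_iff.2 hx
          rw [inv_mul_le_iff₀ hx']
          exact abs_real_inner_le_norm _ _
      rw [Real.norm_of_nonneg (by positivity)]
      calc _ ≤ (radD u x) ^ 2 := div_le_self (sq_nonneg _) (by linarith [norm_nonneg x])
        _ = |radD u x| ^ 2 := (sq_abs _).symm
        _ ≤ _ := by gcongr
  have main : ∫ x : E3, (1 / 2 * ((u x) ^ 2 / ((1 + ‖x‖) * (t - ‖x‖ + 3) ^ 2))
      - 2 * ((radD u x) ^ 2 / (1 + ‖x‖))) ≤ 0 := by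
    apply polar_nonpos
    intro w hw
    have hn : ∀ r : ℝ, 0 < r → ‖r • w‖ = r := fun r hr => by
      rw [norm_smul, hw, mul_one, Real.norm_of_nonneg hr.le]
    have := oneD t ht (fun r => u (r • w)) (fun r => ⟪w, gradient u (r • w)⟫) ?_ ?_ ?_ ?_
    · refine le_of_eq_of_le ?_ this
      apply setIntegral_congr_fun measurableSet_Ioi
      intro r hr
      have hr' : (0:ℝ) < r := hr
      have : radD u (r • w) = ⟪w, gradient u (r • w)⟫ := by
        unfold radD
        rw [hn r hr', real_inner_smul_left, inv_mul_cancel_left₀ hr'.ne']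
      simp only [this, hn r hr']
    · intro r
      have h1 : HasFDerivAt u (fderiv ℝ u (r • w)) (r • w) :=
        (hu.differentiable (by norm_num) _).hasFDerivAt
      have h2 : HasDerivAt (fun r : ℝ => r • w) w r := by
        simpa using (hasDerivAt_id r).smul_const w
      refine (h1.comp_hasDerivAt r h2).congr_deriv ?_
      rw [← toDual_gradient, InnerProductSpace.toDual_apply_apply, real_inner_comm]
    · fun_prop
    · intro r hr
      exact hu0 _ (by rw [hn r (by linarith)]; exact hr)
    · intro r hr
      have := hg0 (r • w) (by rw [hn r (by linarith)]; exact hr)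
      simp [this]
  rw [integral_sub (iA.const_mul _) (iB.const_mul _), integral_const_mul, integral_const_mul] at main
  have hnn : 0 ≤ ∫ x : E3, (u x) ^ 2 / ((1 + ‖x‖) * ‖x‖ ^ 2) :=
    integral_nonneg fun x => by positivity
  linarith
end
end

section
/- Weighted Sobolev estimate on dyadic annuli: for h ∈ C^∞(ℝ³) and R ≥ 1, sup_{R < |x| < 2R} |h(x)| ≤ C R^{-1} ( Σ_{|μ| ≤ 2} ‖Γ^μ h‖_{L²(7R/8 < |x| < 17R/8)} ), where Γ ranges over the vector fields {∂₁, ∂₂, ∂₃, Ω₁, Ω₂, Ω₃} (translations and rotations) and C is independent of R and h. For R = 1 the annulus {|x|<2} and enlargement {|x|<17/4} are used instead. -/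
noncomputable section

open MeasureTheory

/-- The vector fields `{id, ∂₁, ∂₂, ∂₃, Ω₁, Ω₂, Ω₃}` (identity included so that words of a
fixed length encode all shorter words). -/
def vf : Unit ⊕ Fin 3 ⊕ Fin 3 → (E3 → ℝ) → E3 → ℝ
  | Sum.inl _ => fun h => h
  | Sum.inr (Sum.inl i) => fun h x => fderiv ℝ h x (EuclideanSpace.single i 1)
  | Sum.inr (Sum.inr j) => fun h x =>
      ![x 1 * gradient h x 2 - x 2 * gradient h x 1,
        x 2 * gradient h x 0 - x 0 * gradient h x 2,
        x 0 * gradient h x 1 - x 1 * gradient h x 0] j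


def XX : Fin 3 ⊕ Fin 3 → E3 → E3
  | Sum.inl i => fun _ => EuclideanSpace.single i 1
  | Sum.inr j => fun y =>
      ![y 1 • EuclideanSpace.single 2 1 - y 2 • EuclideanSpace.single 1 1,
        y 2 • EuclideanSpace.single 0 1 - y 0 • EuclideanSpace.single 2 1,
        y 0 • EuclideanSpace.single 1 1 - y 1 • EuclideanSpace.single 0 1] j

lemma gradient_coord (f : E3 → ℝ) (x : E3) (i : Fin 3) :
    gradient f x i = fderiv ℝ f x (EuclideanSpace.single i 1) := by
  have h := InnerProductSpace.toDual_symm_apply (𝕜 := ℝ) (x := EuclideanSpace.single i (1:ℝ))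
    (y := fderiv ℝ f x)
  rw [← h, EuclideanSpace.inner_single_right]
  simp [gradient]

lemma vf_eq (f : E3 → ℝ) (j : Fin 3 ⊕ Fin 3) (y : E3) :
    vf (Sum.inr j) f y = fderiv ℝ f y (XX j y) := by
  rcases j with i | j
  · rfl
  · fin_cases j <;> simp [vf, XX, gradient_coord]

lemma XX_contDiff (j : Fin 3 ⊕ Fin 3) : ContDiff ℝ (⊤ : ℕ∞) (XX j) := by
  rcases j with i | j
  · exact contDiff_const
  · fin_cases j <;> simp only [XX] <;> simp <;> fun_prop

lemma vf_contDiff (j : Unit ⊕ Fin 3 ⊕ Fin 3) (f : E3 → ℝ) (hf : ContDiff ℝ (⊤ : ℕ∞) f) :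
    ContDiff ℝ (⊤ : ℕ∞) (vf j f) := by
  rcases j with u | j
  · exact hf
  · rw [funext (vf_eq f j)]
    have h1 : ContDiff ℝ (⊤ : ℕ∞) (fderiv ℝ f) := hf.fderiv_right (by simp)
    exact h1.clm_apply (XX_contDiff j)

lemma curve_deriv (f : E3 → ℝ) (hf : ContDiff ℝ (⊤ : ℕ∞) f) (γ : ℝ → E3)
    (c : Fin 3 ⊕ Fin 3 → ℝ → ℝ) (t : ℝ)
    (hγ : HasDerivAt γ (∑ j, c j t • XX j (γ t)) t) :
    HasDerivAt (fun s => f (γ s)) (∑ j, c j t * vf (Sum.inr j) f (γ t)) t := by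
  have h1 := ((hf.differentiable (by simp)).differentiableAt (x := γ t)).hasFDerivAt.comp_hasDerivAt t hγ
  refine h1.congr_deriv ?_
  rw [map_sum]
  simp [vf_eq]

def HH (h : E3 → ℝ) (y : E3) : ℝ :=
  ∑ w : Fin 2 → Unit ⊕ Fin 3 ⊕ Fin 3, |vf (w 0) (vf (w 1) h) y|

lemma HH_ge (h : E3 → ℝ) (y : E3) (a b : Unit ⊕ Fin 3 ⊕ Fin 3) :
    |vf a (vf b h) y| ≤ HH h y := by
  have := Finset.single_le_sum
    (f := fun w : Fin 2 → Unit ⊕ Fin 3 ⊕ Fin 3 => |vf (w 0) (vf (w 1) h) y|)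
    (fun i _ => abs_nonneg _) (Finset.mem_univ ![a, b])
  simpa [HH] using this

lemma HH_cont (h : E3 → ℝ) (hf : ContDiff ℝ (⊤ : ℕ∞) h) : Continuous (HH h) := by
  unfold HH
  refine continuous_finsetSum _ fun w _ => ?_
  exact (vf_contDiff _ _ (vf_contDiff _ _ hf)).continuous.abs

lemma HH_nonneg (h : E3 → ℝ) (y : E3) : 0 ≤ HH h y :=
  Finset.sum_nonneg fun _ _ => abs_nonneg _

lemma oneD_s11 (g g' g'' : ℝ → ℝ) (h1 : ∀ t, HasDerivAt g (g' t) t)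
    (h2 : ∀ t, HasDerivAt g' (g'' t) t) (hc : Continuous g'') :
    g 0 = ∫ t in (0:ℝ)..1, t * (2 * g t - 4 * (1 - t) * g' t + (1 - t) ^ 2 * g'' t) := by
  have c0 : Continuous g := continuous_iff_continuousAt.2 fun t => (h1 t).continuousAt
  have c1 : Continuous g' := continuous_iff_continuousAt.2 fun t => (h2 t).continuousAt
  have key : ∀ t, HasDerivAt (fun t => t * ((1 - t) ^ 2 * g' t - 2 * (1 - t) * g t)
      - (1 - t) ^ 2 * g t) (t * (2 * g t - 4 * (1 - t) * g' t + (1 - t) ^ 2 * g'' t)) t := by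
    intro t
    have hd : HasDerivAt (fun t : ℝ => 1 - t) (-1) t := by
      simpa using (hasDerivAt_id t).const_sub 1
    have hd2 := hd.pow 2
    have := ((hasDerivAt_id t).mul ((hd2.mul (h2 t)).sub ((hd.const_mul 2).mul (h1 t)))).sub
      (hd2.mul (h1 t))
    refine this.congr_deriv ?_
    simp
    ring
  rw [intervalIntegral.integral_eq_sub_of_hasDerivAt (fun t _ => key t)
    (Continuous.intervalIntegrable (by fun_prop) _ _)]
  simp

lemma curve_bound (h : E3 → ℝ) (hf : ContDiff ℝ (⊤ : ℕ∞) h) (γ : ℝ → E3)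
    (c c' : Fin 3 ⊕ Fin 3 → ℝ → ℝ) (M : ℝ)
    (hγ : ∀ t, HasDerivAt γ (∑ j, c j t • XX j (γ t)) t)
    (hc : ∀ j t, HasDerivAt (c j) (c' j t) t) (hc' : ∀ j, Continuous (c' j))
    (hM : ∀ j t, |c j t| ≤ M) (hM' : ∀ j t, |c' j t| ≤ M) :
    |h (γ 0)| ≤ ∫ t in (0:ℝ)..1, t * ((2 + 30 * M + 36 * M ^ 2) * HH h (γ t)) := by
  have cγ : Continuous γ := continuous_iff_continuousAt.2 fun t => (hγ t).continuousAt
  have cc : ∀ j, Continuous (c j) := fun j =>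
    continuous_iff_continuousAt.2 fun t => (hc j t).continuousAt
  have hM0 : 0 ≤ M := (abs_nonneg _).trans (hM (Sum.inl 0) 0)
  have hv := fun j => vf_contDiff (Sum.inr j) h hf
  have hvv := fun j k => vf_contDiff (Sum.inr k) _ (hv j)
  have d1 : ∀ t, HasDerivAt (fun s => h (γ s)) (∑ j, c j t * vf (Sum.inr j) h (γ t)) t :=
    fun t => curve_deriv h hf γ c t (hγ t)
  have d2 : ∀ t, HasDerivAt (fun s => ∑ j, c j s * vf (Sum.inr j) h (γ s))
      (∑ j, (c' j t * vf (Sum.inr j) h (γ t) +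
        c j t * ∑ k, c k t * vf (Sum.inr k) (vf (Sum.inr j) h) (γ t))) t := fun t =>
    HasDerivAt.fun_sum fun j _ => (hc j t).mul (curve_deriv _ (hv j) γ c t (hγ t))
  have c2 : Continuous (fun t => ∑ j, (c' j t * vf (Sum.inr j) h (γ t) +
        c j t * ∑ k, c k t * vf (Sum.inr k) (vf (Sum.inr j) h) (γ t))) := by
    refine continuous_finsetSum _ fun j _ => ((hc' j).mul ((hv j).continuous.comp cγ)).add
      ((cc j).mul (continuous_finsetSum _ fun k _ => (cc k).mul ((hvv j k).continuous.comp cγ)))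
  have c1 := continuous_iff_continuousAt.2 fun t => (d2 t).continuousAt
  have c0 := continuous_iff_continuousAt.2 fun t => (d1 t).continuousAt
  have := oneD_s11 _ _ _ d1 d2 c2
  rw [this, ← Real.norm_eq_abs]
  refine intervalIntegral.norm_integral_le_of_norm_le zero_le_one ?_ ?_
  swap
  · have := HH_cont h hf
    exact Continuous.intervalIntegrable (by fun_prop) _ _
  refine Filter.Eventually.of_forall fun t ht => ?_
  have ht0 := ht.1
  have ht1 := ht.2
  rw [norm_mul, Real.norm_eq_abs, Real.norm_eq_abs, abs_of_pos ht0]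
  refine mul_le_mul_of_nonneg_left ?_ ht0.le
  set H := HH h (γ t) with hH
  have H0 : 0 ≤ H := HH_nonneg _ _
  have b0 : |h (γ t)| ≤ H := HH_ge h (γ t) (Sum.inl ()) (Sum.inl ())
  have b1 : ∀ j, |vf (Sum.inr j) h (γ t)| ≤ H := fun j => HH_ge h (γ t) (Sum.inr j) (Sum.inl ())
  have b2 : ∀ j k, |vf (Sum.inr k) (vf (Sum.inr j) h) (γ t)| ≤ H := fun j k =>
    HH_ge h (γ t) (Sum.inr k) (Sum.inr j)
  have e1 : |∑ j, c j t * vf (Sum.inr j) h (γ t)| ≤ 6 * (M * H) := by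
    refine (Finset.abs_sum_le_sum_abs _ _).trans ?_
    refine (Finset.sum_le_card_nsmul _ _ (M * H) fun j _ => ?_).trans (by simp)
    rw [abs_mul]
    exact mul_le_mul (hM j t) (b1 j) (abs_nonneg _) hM0
  have e2 : ∀ j, |∑ k, c k t * vf (Sum.inr k) (vf (Sum.inr j) h) (γ t)| ≤ 6 * (M * H) := by
    intro j
    refine (Finset.abs_sum_le_sum_abs _ _).trans ?_
    refine (Finset.sum_le_card_nsmul _ _ (M * H) fun k _ => ?_).trans (by simp)
    rw [abs_mul]
    exact mul_le_mul (hM k t) (b2 j k) (abs_nonneg _) hM0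
  have e3 : |∑ j, (c' j t * vf (Sum.inr j) h (γ t) +
        c j t * ∑ k, c k t * vf (Sum.inr k) (vf (Sum.inr j) h) (γ t))|
        ≤ 6 * (M * H + M * (6 * (M * H))) := by
    refine (Finset.abs_sum_le_sum_abs _ _).trans ?_
    refine (Finset.sum_le_card_nsmul _ _ (M * H + M * (6 * (M * H))) fun j _ => ?_).trans (by simp; linarith)
    refine (abs_add_le _ _).trans ?_
    rw [abs_mul, abs_mul]
    exact add_le_add (mul_le_mul (hM' j t) (b1 j) (abs_nonneg _) hM0)
      (mul_le_mul (hM j t) (e2 j) (abs_nonneg _) hM0)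
  set A := ∑ j, c j t * vf (Sum.inr j) h (γ t)
  set B := ∑ j, (c' j t * vf (Sum.inr j) h (γ t) +
        c j t * ∑ k, c k t * vf (Sum.inr k) (vf (Sum.inr j) h) (γ t))
  have f1 : |4 * (1 - t) * A| ≤ 4 * (6 * (M * H)) := by
    rw [abs_mul]
    refine mul_le_mul ?_ e1 (abs_nonneg _) (by norm_num)
    rw [abs_le]; constructor <;> linarith
  have f2 : |(1 - t) ^ 2 * B| ≤ 1 * (6 * (M * H + M * (6 * (M * H)))) := by
    rw [abs_mul]
    refine mul_le_mul ?_ e3 (abs_nonneg _) (by norm_num)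
    rw [abs_le]; constructor <;> nlinarith
  rw [abs_le] at *
  constructor <;> nlinarith

lemma avg_aux (F : (Fin 3 → ℝ) → ℝ) (cF : Continuous F) (m M J l : ℝ) (hM : 0 ≤ M)
    (hl : 0 < l)
    (h1 : ∀ z ∈ Metric.ball (0 : Fin 3 → ℝ) 1, m ≤ ∫ t in (0:ℝ)..1, t * (M * F (t • z)))
    (h2 : ∫ z in Metric.ball (0 : Fin 3 → ℝ) 1, F z ^ 2 ≤ J) :
    8 * m ≤ M * (8 * l + J / l) := by
  set B := Metric.ball (0 : Fin 3 → ℝ) 1 with hB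
  have hvol : (volume : Measure (Fin 3 → ℝ)).real B = 8 := by
    rw [Measure.real, hB, Real.volume_pi_ball _ one_pos]
    norm_num
  have hBm : MeasurableSet B := measurableSet_ball
  have hon : ∀ G : (Fin 3 → ℝ) → ℝ, Continuous G → IntegrableOn G B := fun G hG =>
    (hG.continuousOn.integrableOn_compact (isCompact_closedBall (0 : Fin 3 → ℝ) 1)).mono_set
      Metric.ball_subset_closedBall
  have hprod : Integrable (Function.uncurry fun (z : Fin 3 → ℝ) (t : ℝ) => t * (M * F (t • z)))
      ((volume.restrict B).prod (volume.restrict (Set.Ioc (0:ℝ) 1))) := by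
    rw [Measure.prod_restrict]
    have hc : Continuous (Function.uncurry fun (z : Fin 3 → ℝ) (t : ℝ) => t * (M * F (t • z))) := by
      unfold Function.uncurry
      fun_prop
    refine (hc.continuousOn.integrableOn_compact
      ((isCompact_closedBall (0 : Fin 3 → ℝ) 1).prod (isCompact_Icc (a := (0:ℝ)) (b := 1)))).mono_set ?_
    exact Set.prod_mono Metric.ball_subset_closedBall Set.Ioc_subset_Icc_self
  have step1 : 8 * m ≤ ∫ z in B, ∫ t in Set.Ioc (0:ℝ) 1, t * (M * F (t • z)) := by
    have : 8 * m = ∫ z in B, m := by simp [hvol]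
    rw [this]
    refine setIntegral_mono_on (hon _ continuous_const) hprod.integral_prod_left hBm fun z hz => ?_
    rw [← intervalIntegral.integral_of_le zero_le_one]
    exact h1 z hz
  rw [integral_integral_swap hprod] at step1
  have hint : IntervalIntegrable (fun t : ℝ => t ^ (-(1/2) : ℝ)) volume 0 1 :=
    intervalIntegral.intervalIntegrable_rpow' (by norm_num)
  have hval : ∫ t in (0:ℝ)..1, t ^ (-(1/2) : ℝ) = 2 := by
    rw [integral_rpow (Or.inl (by norm_num))]
    norm_num
  have step2 : ∫ t in Set.Ioc (0:ℝ) 1, ∫ z in B, t * (M * F (t • z)) ≤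
      ∫ t in Set.Ioc (0:ℝ) 1, (M * (4 * l + J / (2 * l))) * t ^ (-(1/2) : ℝ) := by
    refine setIntegral_mono_on hprod.integral_prod_right ?_ measurableSet_Ioc fun t ht => ?_
    · exact ((intervalIntegrable_iff_integrableOn_Ioc_of_le zero_le_one).1 hint).const_mul _
    have ht0 : 0 < t := ht.1
    set s := t ^ (-(1/2) : ℝ) with hs
    have hs0 : 0 < s := Real.rpow_pos_of_pos ht0 _
    have hst : s ^ 2 * t = 1 := by
      rw [hs, ← Real.rpow_natCast, ← Real.rpow_mul ht0.le]
      norm_num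
      rw [Real.rpow_neg_one]
      field_simp
    have hsc : ∫ z in B, F (t • z) ^ 2 ≤ (t ^ 3)⁻¹ * J := by
      rw [Measure.setIntegral_comp_smul_of_pos volume (fun z => F z ^ 2) B ht0]
      simp only [Module.finrank_fintype_fun_eq_card, Fintype.card_fin, smul_eq_mul]
      refine mul_le_mul_of_nonneg_left (le_trans ?_ h2) (by positivity)
      refine setIntegral_mono_set (hon _ (by fun_prop)) (Filter.Eventually.of_forall fun z => sq_nonneg _) ?_
      refine LE.le.eventuallyLE ?_
      rintro _ ⟨z, hz, rfl⟩
      simp only [hB, mem_ball_zero_iff] at hz ⊢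
      rw [norm_smul, Real.norm_eq_abs, abs_of_pos ht0]
      nlinarith [ht.2, norm_nonneg z]
    have hpt : ∀ z, t * (M * F (t • z)) ≤ M * (l * s / 2) + (M * (t ^ 3 * s / (2 * l))) * F (t • z) ^ 2 := by
      intro z
      have hh : t * F (t • z) ≤ l * s / 2 + t ^ 3 * s / (2 * l) * F (t • z) ^ 2 := by
        have : l * s / 2 + t ^ 3 * s / (2 * l) * F (t • z) ^ 2 - t * F (t • z)
            = s / (2 * l) * (l - t * t * s * F (t • z)) ^ 2 := by
          field_simp
          linear_combination (2 * F (t • z) * t * l - F (t • z) ^ 2 * t ^ 3 * s ) * hst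
        have h3 : 0 ≤ s / (2 * l) * (l - t * t * s * F (t • z)) ^ 2 := by positivity
        linarith
      nlinarith
    calc ∫ z in B, t * (M * F (t • z)) ≤
        ∫ z in B, (M * (l * s / 2) + (M * (t ^ 3 * s / (2 * l))) * F (t • z) ^ 2) :=
          setIntegral_mono_on (hon _ (by fun_prop)) (hon _ (by fun_prop)) hBm fun z _ => hpt z
      _ = 8 * (M * (l * s / 2)) + (M * (t ^ 3 * s / (2 * l))) * ∫ z in B, F (t • z) ^ 2 := by
          rw [integral_add (hon _ continuous_const) (hon _ (by fun_prop)),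
            integral_const_mul (M * (t ^ 3 * s / (2 * l)))]
          simp only [integral_const, measureReal_restrict_apply_univ, hvol, smul_eq_mul]
      _ ≤ 8 * (M * (l * s / 2)) + (M * (t ^ 3 * s / (2 * l))) * ((t ^ 3)⁻¹ * J) := by
          gcongr
      _ = (M * (4 * l + J / (2 * l))) * s := by
          field_simp
          ring
  rw [← intervalIntegral.integral_of_le zero_le_one, ← intervalIntegral.integral_of_le zero_le_one,
    intervalIntegral.integral_const_mul, hval] at step2
  rw [← intervalIntegral.integral_of_le zero_le_one] at step1
  refine step1.trans (step2.trans (le_of_eq ?_))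
  field_simp
  ring

lemma avg (F : (Fin 3 → ℝ) → ℝ) (cF : Continuous F) (m M J : ℝ) (hM : 0 ≤ M) (hJ : 0 ≤ J)
    (h1 : ∀ z ∈ Metric.ball (0 : Fin 3 → ℝ) 1, m ≤ ∫ t in (0:ℝ)..1, t * (M * F (t • z)))
    (h2 : ∫ z in Metric.ball (0 : Fin 3 → ℝ) 1, F z ^ 2 ≤ J) :
    m ≤ 2 * M * √J := by
  refine le_of_forall_pos_le_add fun ε hε => ?_
  have hl : 0 < √J + ε / (M + 1) := by positivity
  have := avg_aux F cF m M J _ hM hl h1 h2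
  have h3 : J / (√J + ε / (M + 1)) ≤ √J := by
    rw [div_le_iff₀ hl]
    have h4 := Real.mul_self_sqrt hJ
    have : 0 ≤ √J * (ε / (M + 1)) := by positivity
    nlinarith
  have h5 : M * (ε / (M + 1)) ≤ ε := by
    rw [mul_div_assoc', div_le_iff₀ (by positivity)]
    nlinarith
  have h6 := mul_le_mul_of_nonneg_left h3 hM
  have h7 := mul_nonneg hM (Real.sqrt_nonneg J)
  nlinarith

def Psi (ρ : ℝ) (z : Fin 3 → ℝ) : Fin 3 → ℝ :=
  ![(ρ + z 0 / 8) * (Real.cos (z 2) * Real.cos (z 1)),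
    (ρ + z 0 / 8) * (Real.cos (z 2) * Real.sin (z 1)), (ρ + z 0 / 8) * Real.sin (z 2)]

def MatA (ρ : ℝ) (z : Fin 3 → ℝ) : Matrix (Fin 3) (Fin 3) ℝ :=
  !![Real.cos (z 2) * Real.cos (z 1) / 8, -((ρ + z 0 / 8) * (Real.cos (z 2) * Real.sin (z 1))),
      -((ρ + z 0 / 8) * (Real.sin (z 2) * Real.cos (z 1)));
    Real.cos (z 2) * Real.sin (z 1) / 8, (ρ + z 0 / 8) * (Real.cos (z 2) * Real.cos (z 1)),
      -((ρ + z 0 / 8) * (Real.sin (z 2) * Real.sin (z 1)));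
    Real.sin (z 2) / 8, 0, (ρ + z 0 / 8) * Real.cos (z 2)]

lemma MatA_det (ρ : ℝ) (z : Fin 3 → ℝ) :
    (LinearMap.toContinuousLinearMap (Matrix.toLin' (MatA ρ z))).det =
      (ρ + z 0 / 8) ^ 2 * Real.cos (z 2) / 8 := by
  rw [LinearMap.det_toContinuousLinearMap, LinearMap.det_toLin', Matrix.det_fin_three]
  simp only [MatA, Matrix.of_apply, Matrix.cons_val', Matrix.cons_val_zero, Matrix.cons_val_one,
    Matrix.cons_val]
  have h1 := Real.sin_sq_add_cos_sq (z 1)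
  have h2 := Real.sin_sq_add_cos_sq (z 2)
  linear_combination ((ρ + z 0 / 8) ^ 2 * Real.cos (z 2) / 8) * h2 +
   ((ρ + z 0 / 8) ^ 2 * Real.cos (z 2) / 8 * (Real.sin (z 2) ^ 2 + Real.cos (z 2) ^ 2)) * h1

lemma Psi_deriv (ρ : ℝ) (z : Fin 3 → ℝ) :
    HasFDerivAt (Psi ρ) (LinearMap.toContinuousLinearMap (Matrix.toLin' (MatA ρ z))) z := by
  have p : ∀ i : Fin 3, HasFDerivAt (fun y : Fin 3 → ℝ => y i)
    (ContinuousLinearMap.proj (R := ℝ) (φ := fun _ : Fin 3 => ℝ) i) z := fun i => hasFDerivAt_apply i z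
  have hr : HasFDerivAt (fun y : Fin 3 → ℝ => ρ + y 0 / 8)
    ((8:ℝ)⁻¹ • ContinuousLinearMap.proj (R := ℝ) (φ := fun _ : Fin 3 => ℝ) 0) z := by
    have := ((p 0).mul_const (8:ℝ)⁻¹).const_add ρ
    simpa [div_eq_mul_inv] using this
  rw [hasFDerivAt_pi']
  intro i
  fin_cases i
  · refine (hr.mul ((p 2).cos.mul (p 1).cos)).congr_fderiv ?_
    ext v
    simp [MatA, dotProduct, Fin.sum_univ_three]
    ring
  · refine (hr.mul ((p 2).cos.mul (p 1).sin)).congr_fderiv ?_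
    ext v
    simp [MatA, dotProduct, Fin.sum_univ_three]
    ring
  · refine (hr.mul (p 2).sin).congr_fderiv ?_
    ext v
    simp [MatA, dotProduct, Fin.sum_univ_three]
    ring

lemma ball_coord {z : Fin 3 → ℝ} (hz : z ∈ Metric.ball (0 : Fin 3 → ℝ) 1) (i : Fin 3) :
    |z i| < 1 := by
  rw [mem_ball_zero_iff] at hz
  exact (norm_le_pi_norm z i).trans_lt hz

lemma Psi_inj (ρ : ℝ) (hρ : 1 ≤ ρ) : Set.InjOn (Psi ρ) (Metric.ball (0 : Fin 3 → ℝ) 1) := by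
  intro z hz w hw heq
  have hz' := fun i => abs_lt.1 (ball_coord hz i)
  have hw' := fun i => abs_lt.1 (ball_coord hw i)
  have e0 := congrFun heq 0
  have e1 := congrFun heq 1
  have e2 := congrFun heq 2
  simp [Psi] at e0 e1 e2
  have hp := Real.pi_gt_three
  have q1 : 0 < ρ + z 0 / 8 := by linarith [hz' 0]
  have q2 : 0 < ρ + w 0 / 8 := by linarith [hw' 0]
  have r : ρ + z 0 / 8 = ρ + w 0 / 8 := by
    rw [← sq_eq_sq₀ q1.le q2.le]
    have s1 := Real.sin_sq_add_cos_sq (z 1)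
    have s2 := Real.sin_sq_add_cos_sq (z 2)
    have s3 := Real.sin_sq_add_cos_sq (w 1)
    have s4 := Real.sin_sq_add_cos_sq (w 2)
    have a0 := congrArg (· ^ 2) e0
    have a1 := congrArg (· ^ 2) e1
    have a2 := congrArg (· ^ 2) e2
    linear_combination a0 + a1 + a2 - (ρ + z 0 / 8) ^ 2 * s2
      - (ρ + z 0 / 8) ^ 2 * Real.cos (z 2) ^ 2 * s1 + (ρ + w 0 / 8) ^ 2 * s4
      + (ρ + w 0 / 8) ^ 2 * Real.cos (w 2) ^ 2 * s3
  rw [r] at e1 e2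
  have f2 := mul_left_cancel₀ q2.ne' e2
  have g2 : z 2 = w 2 := Real.injOn_sin ⟨by linarith [hz' 2], by linarith [hz' 2]⟩
    ⟨by linarith [hw' 2], by linarith [hw' 2]⟩ f2
  rw [g2] at e1
  have hc : 0 < Real.cos (w 2) := Real.cos_pos_of_mem_Ioo ⟨by linarith [hw' 2], by linarith [hw' 2]⟩
  have f1 := mul_left_cancel₀ hc.ne' (mul_left_cancel₀ q2.ne' e1)
  have g1 : z 1 = w 1 := Real.injOn_sin ⟨by linarith [hz' 1], by linarith [hz' 1]⟩
    ⟨by linarith [hw' 1], by linarith [hw' 1]⟩ f1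
  ext i
  fin_cases i
  · show z 0 = w 0
    linarith
  · exact g1
  · exact g2

lemma Psi_norm (ρ : ℝ) (z : Fin 3 → ℝ) (h : 0 ≤ ρ + z 0 / 8) :
    ‖(WithLp.toLp 2 (Psi ρ z) : E3)‖ = ρ + z 0 / 8 := by
  rw [EuclideanSpace.norm_eq, Real.sqrt_eq_iff_mul_self_eq (by positivity) h]
  simp [Fin.sum_univ_three, Psi]
  have s1 := Real.sin_sq_add_cos_sq (z 1)
  have s2 := Real.sin_sq_add_cos_sq (z 2)
  linear_combination (ρ + z 0 / 8) ^ 2 * s2 + (ρ + z 0 / 8) ^ 2 * Real.cos (z 2) ^ 2 * s1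

lemma Psi_cont (ρ : ℝ) : Continuous (Psi ρ) :=
  continuous_iff_continuousAt.2 fun z => (Psi_deriv ρ z).continuousAt

lemma chart_int (R ρ : ℝ) (hR : 1 ≤ R) (h1 : R < ρ) (h2 : ρ < 2 * R) (Q : E3 ≃ₗᵢ[ℝ] E3)
    (F : E3 → ℝ) (hF : Continuous F) :
    ∫ z in Metric.ball (0 : Fin 3 → ℝ) 1, F (Q (WithLp.toLp 2 (Psi ρ z))) ^ 2 ≤
      100 * R⁻¹ ^ 2 * ∫ y in {y : E3 | 7 * R / 8 < ‖y‖ ∧ ‖y‖ < 17 * R / 8}, F y ^ 2 := by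
  set S := {y : E3 | 7 * R / 8 < ‖y‖ ∧ ‖y‖ < 17 * R / 8} with hS
  set B := Metric.ball (0 : Fin 3 → ℝ) 1 with hB
  have hSm : MeasurableSet S := by
    refine (IsOpen.inter (isOpen_lt continuous_const continuous_norm)
      (isOpen_lt continuous_norm continuous_const)).measurableSet
  have hSint : IntegrableOn (fun y => F y ^ 2) S := by
    refine ((hF.pow 2).continuousOn.integrableOn_compact
      (isCompact_closedBall (0 : E3) (17 * R / 8))).mono_set fun y hy => ?_
    rw [mem_closedBall_zero_iff]
    exact hy.2.le
  let T : (Fin 3 → ℝ) ≃ᵐ E3 := (MeasurableEquiv.toLp 2 (Fin 3 → ℝ)).trans Q.toMeasurableEquiv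
  have hT : MeasurePreserving T := Q.measurePreserving.comp (PiLp.volume_preserving_toLp (Fin 3))
  have hTa : ∀ z, T z = Q (WithLp.toLp 2 z) := fun z => rfl
  have e1 : ∫ y in S, F y ^ 2 = ∫ z in T ⁻¹' S, F (T z) ^ 2 :=
    (hT.setIntegral_preimage_emb T.measurableEmbedding (fun y => F y ^ 2) S).symm
  have hTint : IntegrableOn (fun z => F (T z) ^ 2) (T ⁻¹' S) :=
    (hT.integrableOn_comp_preimage T.measurableEmbedding).2 hSint
  have hsub : Psi ρ '' B ⊆ T ⁻¹' S := by
    rintro _ ⟨z, hz, rfl⟩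
    have hz' := abs_lt.1 (ball_coord hz 0)
    rw [Set.mem_preimage, hTa, hS, Set.mem_ofPred_eq, Q.norm_map, Psi_norm _ _ (by linarith)]
    constructor <;> linarith
  have e2 : ∫ z in Psi ρ '' B, F (T z) ^ 2 ≤ ∫ z in T ⁻¹' S, F (T z) ^ 2 :=
    setIntegral_mono_set hTint (Filter.Eventually.of_forall fun z => sq_nonneg _)
      (LE.le.eventuallyLE hsub)
  rw [integral_image_eq_integral_abs_det_fderiv_smul volume measurableSet_ball
    (fun z _ => (Psi_deriv ρ z).hasFDerivWithinAt) (Psi_inj ρ (by linarith))] at e2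
  have cQ : Continuous fun z => F (Q (WithLp.toLp 2 (Psi ρ z))) ^ 2 := by
    have := Psi_cont ρ
    have := Q.continuous
    fun_prop
  have hon : ∀ G : (Fin 3 → ℝ) → ℝ, Continuous G → IntegrableOn G B := fun G hG =>
    (hG.continuousOn.integrableOn_compact (isCompact_closedBall (0 : Fin 3 → ℝ) 1)).mono_set
      Metric.ball_subset_closedBall
  have e3 : ∫ z in B, R ^ 2 / 100 * F (Q (WithLp.toLp 2 (Psi ρ z))) ^ 2 ≤ ∫ z in B,
      |(LinearMap.toContinuousLinearMap (Matrix.toLin' (MatA ρ z))).det| • F (T (Psi ρ z)) ^ 2 := by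
    simp only [MatA_det, smul_eq_mul, hTa]
    refine setIntegral_mono_on (hon _ (by fun_prop)) (hon _ (by fun_prop)) measurableSet_ball
      fun z hz => ?_
    refine mul_le_mul_of_nonneg_right ?_ (sq_nonneg _)
    refine le_trans ?_ (le_abs_self _)
    have hz0 := abs_lt.1 (ball_coord hz 0)
    have hz2 := ball_coord hz 2
    have hc := Real.one_sub_sq_div_two_le_cos (x := z 2)
    have hq : z 2 ^ 2 ≤ 1 := by
      rw [← sq_abs]; nlinarith [abs_nonneg (z 2)]
    have hc' : 1 / 2 ≤ Real.cos (z 2) := by linarith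
    have hr : 7 / 8 * R ≤ ρ + z 0 / 8 := by linarith
    have hr2 : (7 / 8 * R) ^ 2 ≤ (ρ + z 0 / 8) ^ 2 := by gcongr
    have : (7 / 8 * R) ^ 2 * (1 / 2) ≤ (ρ + z 0 / 8) ^ 2 * Real.cos (z 2) := by gcongr
    nlinarith
  rw [integral_const_mul] at e3
  rw [e1]
  have e4 := e3.trans e2
  have hR0 : 0 < R := by linarith
  calc _ = 100 * R⁻¹ ^ 2 * (R ^ 2 / 100 * ∫ z in B, F (Q (WithLp.toLp 2 (Psi ρ z))) ^ 2) := by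
        field_simp
    _ ≤ _ := by gcongr

lemma coord_deriv {n : ℝ → E3} {n' : E3} {t : ℝ} (h : HasDerivAt n n' t) (i : Fin 3) :
    HasDerivAt (fun s => n s i) (n' i) t :=
  (EuclideanSpace.proj (𝕜 := ℝ) i : E3 →L[ℝ] ℝ).hasFDerivAt.comp_hasDerivAt t h

lemma sphere_curve (h : E3 → ℝ) (hf : ContDiff ℝ (⊤ : ℕ∞) h) (n n' n'' : ℝ → E3) (ρ s : ℝ)
    (hs : |s| ≤ 1)
    (d1 : ∀ t, HasDerivAt n (n' t) t) (d2 : ∀ t, HasDerivAt n' (n'' t) t) (hc : Continuous n'')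
    (i1 : ∀ t, n t 0 * n t 0 + n t 1 * n t 1 + n t 2 * n t 2 = 1)
    (i2 : ∀ t, n t 0 * n' t 0 + n t 1 * n' t 1 + n t 2 * n' t 2 = 0)
    (b0 : ∀ t i, |n t i| ≤ 3) (b1 : ∀ t i, |n' t i| ≤ 6) (b2 : ∀ t i, |n'' t i| ≤ 12) :
    |h ((ρ + 0 * s) • n 0)| ≤ ∫ t in (0:ℝ)..1,
      t * ((2 + 30 * 200 + 36 * 200 ^ 2) * HH h ((ρ + t * s) • n t)) := by
  have c0 : Continuous n := continuous_iff_continuousAt.2 fun t => (d1 t).continuousAt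
  have hX : ∀ a b c d A B : ℝ, |a| ≤ A → |b| ≤ B → |c| ≤ A → |d| ≤ B →
      |a * b - c * d| ≤ 2 * (A * B) := by
    intro a b c d A B ha hb hc hd
    refine (abs_sub _ _).trans ?_
    rw [abs_mul, abs_mul]
    have hA := (abs_nonneg _).trans ha
    have := mul_le_mul ha hb (abs_nonneg _) hA
    have := mul_le_mul hc hd (abs_nonneg _) hA
    linarith
  refine curve_bound h hf (fun t => (ρ + t * s) • n t)
    (fun j t => match j with
      | Sum.inl i => s * n t i
      | Sum.inr j => ![n t 1 * n' t 2 - n t 2 * n' t 1, n t 2 * n' t 0 - n t 0 * n' t 2,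
          n t 0 * n' t 1 - n t 1 * n' t 0] j)
    (fun j t => match j with
      | Sum.inl i => s * n' t i
      | Sum.inr j => ![n t 1 * n'' t 2 - n t 2 * n'' t 1, n t 2 * n'' t 0 - n t 0 * n'' t 2,
          n t 0 * n'' t 1 - n t 1 * n'' t 0] j) 200 ?_ ?_ ?_ ?_ ?_
  · intro t
    have hr : HasDerivAt (fun t : ℝ => ρ + t * s) s t := by
      simpa using ((hasDerivAt_id t).mul_const s).const_add ρ
    refine (hr.smul (d1 t)).congr_deriv ?_
    have j1 := i1 t
    have j2 := i2 t
    ext i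
    fin_cases i <;> simp [XX, Fintype.sum_sum_type, Fin.sum_univ_three]
    · linear_combination (-(ρ + t * s) * n' t 0) * j1 + (ρ + t * s) * n t 0 * j2
    · linear_combination (-(ρ + t * s) * n' t 1) * j1 + (ρ + t * s) * n t 1 * j2
    · linear_combination (-(ρ + t * s) * n' t 2) * j1 + (ρ + t * s) * n t 2 * j2
  · intro j t
    have k1 := fun i => coord_deriv (d1 t) i
    have k2 := fun i => coord_deriv (d2 t) i
    rcases j with i | j
    · exact (k1 i).const_mul s
    · fin_cases j
      · exact (((k1 1).mul (k2 2)).sub ((k1 2).mul (k2 1))).congr_deriv (by simp; ring)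
      · exact (((k1 2).mul (k2 0)).sub ((k1 0).mul (k2 2))).congr_deriv (by simp; ring)
      · exact (((k1 0).mul (k2 1)).sub ((k1 1).mul (k2 0))).congr_deriv (by simp; ring)
  · have c1 : Continuous n' := continuous_iff_continuousAt.2 fun t => (d2 t).continuousAt
    intro j
    rcases j with i | j
    · simp only; fun_prop
    · fin_cases j <;> simp <;> fun_prop
  · intro j t
    rcases j with i | j
    · simp only [abs_mul]
      have := mul_le_mul hs (b0 t i) (abs_nonneg _) zero_le_one
      linarith
    · fin_cases j <;> simp <;>
        exact (hX _ _ _ _ 3 6 (b0 _ _) (b1 _ _) (b0 _ _) (b1 _ _)).trans (by norm_num)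
  · intro j t
    rcases j with i | j
    · simp only [abs_mul]
      have := mul_le_mul hs (b1 t i) (abs_nonneg _) zero_le_one
      linarith
    · fin_cases j <;> simp <;>
        exact (hX _ _ _ _ 3 12 (b0 _ _) (b2 _ _) (b0 _ _) (b2 _ _)).trans (by norm_num)

lemma Q_bound (Q : E3 ≃ₗᵢ[ℝ] E3) (w : Fin 3 → ℝ) (K : ℝ) (hw : ∀ i, |w i| ≤ K) (i : Fin 3) :
    |Q (WithLp.toLp 2 w) i| ≤ 3 * K := by
  have hK := (abs_nonneg _).trans (hw 0)
  refine (PiLp.norm_apply_le (Q (WithLp.toLp 2 w)) i).trans ?_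
  rw [Q.norm_map, EuclideanSpace.norm_eq]
  refine Real.sqrt_le_iff.2 ⟨by positivity, ?_⟩
  have hw2 : ∀ i, w i ^ 2 ≤ K ^ 2 := fun i => sq_le_sq' (abs_le.1 (hw i)).1 (abs_le.1 (hw i)).2
  simp [Fin.sum_univ_three]
  nlinarith [hw2 0, hw2 1, hw2 2, sq_nonneg K]

lemma Q_inner (Q : E3 ≃ₗᵢ[ℝ] E3) (v w : Fin 3 → ℝ) :
    Q (WithLp.toLp 2 v) 0 * Q (WithLp.toLp 2 w) 0 + Q (WithLp.toLp 2 v) 1 * Q (WithLp.toLp 2 w) 1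
     + Q (WithLp.toLp 2 v) 2 * Q (WithLp.toLp 2 w) 2 = v 0 * w 0 + v 1 * w 1 + v 2 * w 2 := by
  have := Q.inner_map_map (WithLp.toLp 2 v) (WithLp.toLp 2 w)
  simp only [PiLp.inner_apply, Fin.sum_univ_three, RCLike.inner_apply, conj_trivial] at this
  linarith

lemma Q_deriv (Q : E3 ≃ₗᵢ[ℝ] E3) (v : ℝ → Fin 3 → ℝ) (v' : Fin 3 → ℝ) (t : ℝ)
    (h : ∀ i, HasDerivAt (fun s => v s i) (v' i) t) :
    HasDerivAt (fun s => Q (WithLp.toLp 2 (v s))) (Q (WithLp.toLp 2 v')) t := by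
  have h1 := hasDerivAt_pi.2 h
  have h2 := (((PiLp.continuousLinearEquiv 2 ℝ (fun _ : Fin 3 => ℝ)).symm.trans
    Q.toContinuousLinearEquiv).toContinuousLinearMap).hasFDerivAt.comp_hasDerivAt t h1
  exact h2

lemma m3 (a b c : ℝ) (ha : |a| ≤ 1) (hb : |b| ≤ 1) (hc : |c| ≤ 1) : |a * b * c| ≤ 1 := by
  rw [abs_mul, abs_mul]
  exact mul_le_one₀ (mul_le_one₀ ha (abs_nonneg _) hb) (abs_nonneg _) hc

lemma chart_curve (h : E3 → ℝ) (hf : ContDiff ℝ (⊤ : ℕ∞) h) (Q : E3 ≃ₗᵢ[ℝ] E3) (ρ : ℝ)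
    (z : Fin 3 → ℝ) (hz : z ∈ Metric.ball (0 : Fin 3 → ℝ) 1) :
    |h (ρ • Q (EuclideanSpace.single 0 1))| ≤ ∫ t in (0:ℝ)..1,
      t * ((2 + 30 * 200 + 36 * 200 ^ 2) * HH h (Q (WithLp.toLp 2 (Psi ρ (t • z))))) := by
  have hz' := fun i => (ball_coord hz i).le
  obtain ⟨a, ha⟩ : ∃ a, a = z 1 := ⟨_, rfl⟩
  obtain ⟨b, hb⟩ : ∃ b, b = z 2 := ⟨_, rfl⟩
  have ha1 : |a| ≤ 1 := ha ▸ hz' 1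
  have hb1 : |b| ≤ 1 := hb ▸ hz' 2
  have key := sphere_curve h hf
    (fun t => Q (WithLp.toLp 2 ![Real.cos (t * b) * Real.cos (t * a),
      Real.cos (t * b) * Real.sin (t * a), Real.sin (t * b)]))
    (fun t => Q (WithLp.toLp 2 ![
      -(b * Real.sin (t * b) * Real.cos (t * a)) - a * Real.cos (t * b) * Real.sin (t * a),
      -(b * Real.sin (t * b) * Real.sin (t * a)) + a * Real.cos (t * b) * Real.cos (t * a),
      b * Real.cos (t * b)]))
    (fun t => Q (WithLp.toLp 2 ![
      -((b * b) * Real.cos (t * b) * Real.cos (t * a))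
        + 2 * ((a * b) * Real.sin (t * b) * Real.sin (t * a))
        - (a * a) * Real.cos (t * b) * Real.cos (t * a),
      -((b * b) * Real.cos (t * b) * Real.sin (t * a))
        - 2 * ((a * b) * Real.sin (t * b) * Real.cos (t * a))
        - (a * a) * Real.cos (t * b) * Real.sin (t * a),
      -((b * b) * Real.sin (t * b) * 1)])) ρ (z 0 / 8)
    (by rw [abs_div]; have := hz' 0; norm_num; linarith) ?_ ?_ ?_ ?_ ?_ ?_ ?_ ?_
  · have e : ∀ t : ℝ, Q (WithLp.toLp 2 (Psi ρ (t • z))) = (ρ + t * (z 0 / 8)) •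
        Q (WithLp.toLp 2 ![Real.cos (t * b) * Real.cos (t * a),
          Real.cos (t * b) * Real.sin (t * a), Real.sin (t * b)]) := by
      intro t
      rw [← map_smul]
      congr 1
      ext i
      fin_cases i <;> simp [Psi, ha, hb, mul_div_assoc]
    simp only [e]
    convert key using 3
    congr 2
    · simp
    · ext i
      fin_cases i <;> simp
  all_goals
    have hsa : ∀ t : ℝ, HasDerivAt (fun t => Real.sin (t * a)) (Real.cos (t * a) * a) t := fun t => by
      simpa using ((hasDerivAt_id t).mul_const a).sin
    have hca : ∀ t : ℝ, HasDerivAt (fun t => Real.cos (t * a)) (-Real.sin (t * a) * a) t := fun t => by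
      simpa using ((hasDerivAt_id t).mul_const a).cos
    have hsb : ∀ t : ℝ, HasDerivAt (fun t => Real.sin (t * b)) (Real.cos (t * b) * b) t := fun t => by
      simpa using ((hasDerivAt_id t).mul_const b).sin
    have hcb : ∀ t : ℝ, HasDerivAt (fun t => Real.cos (t * b)) (-Real.sin (t * b) * b) t := fun t => by
      simpa using ((hasDerivAt_id t).mul_const b).cos
    have S := Real.abs_sin_le_one
    have C := Real.abs_cos_le_one
    have m2 : ∀ x y : ℝ, |x| ≤ 1 → |y| ≤ 1 → |x * y| ≤ 1 := fun x y hx hy => by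
      have := m3 x y 1 hx hy (by simp)
      simpa using this
  · intro t
    refine Q_deriv Q _ _ t fun i => ?_
    fin_cases i
    · exact ((hcb t).mul (hca t)).congr_deriv (by simp; ring)
    · exact ((hcb t).mul (hsa t)).congr_deriv (by simp; ring)
    · exact (hsb t).congr_deriv (by simp; ring)
  · intro t
    refine Q_deriv Q _ _ t fun i => ?_
    fin_cases i
    · exact ((((hsb t).const_mul b).mul (hca t)).neg.sub
        (((hcb t).const_mul a).mul (hsa t))).congr_deriv (by simp; ring)
    · exact ((((hsb t).const_mul b).mul (hsa t)).neg.add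
        (((hcb t).const_mul a).mul (hca t))).congr_deriv (by simp; ring)
    · exact ((hcb t).const_mul b).congr_deriv (by simp; ring)
  · refine Q.continuous.comp ((PiLp.continuous_toLp 2 _).comp (continuous_pi fun i => ?_))
    fin_cases i <;> simp <;> fun_prop
  · intro t
    have s1 := Real.sin_sq_add_cos_sq (t * a)
    have s2 := Real.sin_sq_add_cos_sq (t * b)
    refine (Q_inner Q _ _).trans ?_
    simp
    linear_combination s2 + Real.cos (t * b) ^ 2 * s1
  · intro t
    have s1 := Real.sin_sq_add_cos_sq (t * a)
    refine (Q_inner Q _ _).trans ?_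
    simp
    linear_combination (-b * Real.sin (t * b) * Real.cos (t * b)) * s1
  · intro t i
    refine (Q_bound Q _ 1 (fun i => ?_) i).trans (by norm_num)
    fin_cases i
    · exact m2 _ _ (C _) (C _)
    · exact m2 _ _ (C _) (S _)
    · exact S _
  · intro t i
    refine (Q_bound Q _ 2 (fun i => ?_) i).trans (by norm_num)
    fin_cases i
    · have x1 := m3 _ _ _ hb1 (S (t * b)) (C (t * a))
      have x2 := m3 _ _ _ ha1 (C (t * b)) (S (t * a))
      simp
      rw [abs_le] at *
      constructor <;> linarith
    · have x1 := m3 _ _ _ hb1 (S (t * b)) (S (t * a))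
      have x2 := m3 _ _ _ ha1 (C (t * b)) (C (t * a))
      simp
      rw [abs_le] at *
      constructor <;> linarith
    · exact (m2 _ _ hb1 (C _)).trans (by norm_num)
  · intro t i
    refine (Q_bound Q _ 4 (fun i => ?_) i).trans (by norm_num)
    fin_cases i
    · have x1 := m3 _ _ _ (m2 _ _ hb1 hb1) (C (t * b)) (C (t * a))
      have x2 := m3 _ _ _ (m2 _ _ ha1 hb1) (S (t * b)) (S (t * a))
      have x3 := m3 _ _ _ (m2 _ _ ha1 ha1) (C (t * b)) (C (t * a))
      simp
      rw [abs_le] at *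
      constructor <;> linarith
    · have x1 := m3 _ _ _ (m2 _ _ hb1 hb1) (C (t * b)) (S (t * a))
      have x2 := m3 _ _ _ (m2 _ _ ha1 hb1) (S (t * b)) (C (t * a))
      have x3 := m3 _ _ _ (m2 _ _ ha1 ha1) (C (t * b)) (S (t * a))
      simp
      rw [abs_le] at *
      constructor <;> linarith
    · have x1 := m3 (b * b) (Real.sin (t * b)) 1 (m2 _ _ hb1 hb1) (S _) (by simp)
      simp at x1 ⊢
      linarith

lemma flat_curve (h : E3 → ℝ) (hf : ContDiff ℝ (⊤ : ℕ∞) h) (x : E3)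
    (z : Fin 3 → ℝ) (hz : z ∈ Metric.ball (0 : Fin 3 → ℝ) 1) :
    |h x| ≤ ∫ t in (0:ℝ)..1,
      t * ((2 + 30 * 200 + 36 * 200 ^ 2) * HH h (x + WithLp.toLp 2 (t • z))) := by
  have hz' := fun i => (ball_coord hz i).le
  have := curve_bound h hf (fun t => x + t • (WithLp.toLp 2 z : E3))
    (fun j _ => Sum.elim z (fun _ => 0) j) (fun _ _ => 0) 200 ?_ ?_ ?_ ?_ ?_
  · simpa using this
  · intro t
    have h1 := ((hasDerivAt_id t).smul_const (WithLp.toLp 2 z : E3)).const_add x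
    refine h1.congr_deriv ?_
    ext i
    fin_cases i <;> simp [XX, Fintype.sum_sum_type, Fin.sum_univ_three]
  · intro j t
    exact hasDerivAt_const _ _
  · intro j
    exact continuous_const
  · rintro (j | j) t
    · exact (hz' j).trans (by norm_num)
    · simp
  · simp

lemma flat_int (x : E3) (hx : ‖x‖ < 2) (F : E3 → ℝ) (hF : Continuous F) :
    ∫ z in Metric.ball (0 : Fin 3 → ℝ) 1, F (x + WithLp.toLp 2 z) ^ 2 ≤
      ∫ y in Metric.ball (0 : E3) (17 / 4), F y ^ 2 := by
  set S := Metric.ball (0 : E3) (17 / 4) with hS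
  have hSint : IntegrableOn (fun y => F y ^ 2) S :=
    ((hF.pow 2).continuousOn.integrableOn_compact
      (isCompact_closedBall (0 : E3) (17 / 4))).mono_set Metric.ball_subset_closedBall
  let T : (Fin 3 → ℝ) ≃ᵐ E3 := (MeasurableEquiv.toLp 2 (Fin 3 → ℝ)).trans (MeasurableEquiv.addLeft x)
  have hT : MeasurePreserving T :=
    (measurePreserving_add_left volume x).comp (PiLp.volume_preserving_toLp (Fin 3))
  have hTa : ∀ z, T z = x + WithLp.toLp 2 z := fun z => rfl
  have e1 : ∫ y in S, F y ^ 2 = ∫ z in T ⁻¹' S, F (T z) ^ 2 :=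
    (hT.setIntegral_preimage_emb T.measurableEmbedding (fun y => F y ^ 2) S).symm
  have hTint : IntegrableOn (fun z => F (T z) ^ 2) (T ⁻¹' S) :=
    (hT.integrableOn_comp_preimage T.measurableEmbedding).2 hSint
  rw [e1]
  refine setIntegral_mono_set hTint (Filter.Eventually.of_forall fun z => sq_nonneg _)
      (LE.le.eventuallyLE ?_)
  intro z hz
  have hz' := fun i => ball_coord hz i
  rw [Set.mem_preimage, hTa, hS, mem_ball_zero_iff]
  refine (norm_add_le _ _).trans_lt ?_
  have : ‖(WithLp.toLp 2 z : E3)‖ ≤ 2 := by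
    rw [EuclideanSpace.norm_eq]
    refine Real.sqrt_le_iff.2 ⟨by norm_num, ?_⟩
    have hw2 : ∀ i, z i ^ 2 ≤ 1 ^ 2 := fun i =>
      sq_le_sq' (abs_lt.1 (hz' i)).1.le (abs_lt.1 (hz' i)).2.le
    simp [Fin.sum_univ_three]
    nlinarith [hw2 0, hw2 1, hw2 2]
  linarith

lemma sum_bound (h : E3 → ℝ) (hf : ContDiff ℝ (⊤ : ℕ∞) h) (S : Set E3) (r : ℝ)
    (hS : S ⊆ Metric.closedBall 0 r) :
    √(∫ y in S, HH h y ^ 2) ≤ 7 * ∑ w : Fin 2 → Unit ⊕ Fin 3 ⊕ Fin 3,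
      √(∫ y in S, (vf (w 0) (vf (w 1) h) y) ^ 2) := by
  have hon : ∀ G : E3 → ℝ, Continuous G → IntegrableOn G S := fun G hG =>
    (hG.continuousOn.integrableOn_compact (isCompact_closedBall (0 : E3) r)).mono_set hS
  have hv := fun w : Fin 2 → Unit ⊕ Fin 3 ⊕ Fin 3 =>
    (vf_contDiff (w 0) _ (vf_contDiff (w 1) h hf)).continuous
  have h1 : ∫ y in S, HH h y ^ 2 ≤ 49 * ∑ w : Fin 2 → Unit ⊕ Fin 3 ⊕ Fin 3,
      ∫ y in S, (vf (w 0) (vf (w 1) h) y) ^ 2 := by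
    have hsum := integral_finsetSum (μ := volume.restrict S) Finset.univ
      (f := fun (w : Fin 2 → Unit ⊕ Fin 3 ⊕ Fin 3) y => vf (w 0) (vf (w 1) h) y ^ 2)
      (fun w _ => hon (fun y => vf (w 0) (vf (w 1) h) y ^ 2) ((hv w).pow 2))
    rw [← hsum, ← integral_const_mul]
    refine integral_mono (hon _ ((HH_cont h hf).pow 2))
      (hon _ (continuous_const.mul (continuous_finsetSum _ fun w _ => (hv w).pow 2))) fun y => ?_
    have := sq_sum_le_card_mul_sum_sq (s := Finset.univ)
      (f := fun w : Fin 2 → Unit ⊕ Fin 3 ⊕ Fin 3 => |vf (w 0) (vf (w 1) h) y|)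
    simpa [HH, sq_abs] using this
  refine Real.sqrt_le_iff.2 ⟨by positivity, h1.trans ?_⟩
  rw [mul_pow]
  have h2 := Finset.sum_sq_le_sq_sum_of_nonneg (s := Finset.univ)
    (f := fun w : Fin 2 → Unit ⊕ Fin 3 ⊕ Fin 3 => √(∫ y in S, (vf (w 0) (vf (w 1) h) y) ^ 2))
    (fun w _ => Real.sqrt_nonneg _)
  have h3 : ∀ w : Fin 2 → Unit ⊕ Fin 3 ⊕ Fin 3,
      √(∫ y in S, (vf (w 0) (vf (w 1) h) y) ^ 2) ^ 2 = ∫ y in S, (vf (w 0) (vf (w 1) h) y) ^ 2 :=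
    fun w => Real.sq_sqrt (integral_nonneg fun y => sq_nonneg _)
  simp only [h3] at h2
  linarith

lemma finish (h : E3 → ℝ) (hf : ContDiff ℝ (⊤ : ℕ∞) h) (S : Set E3) (r : ℝ)
    (hS : S ⊆ Metric.closedBall 0 r) (R m : ℝ) (hR : 1 ≤ R) (Φ : (Fin 3 → ℝ) → E3)
    (hΦ : Continuous Φ)
    (h1 : ∀ z ∈ Metric.ball (0 : Fin 3 → ℝ) 1, m ≤ ∫ t in (0:ℝ)..1,
      t * ((2 + 30 * 200 + 36 * 200 ^ 2) * HH h (Φ (t • z))))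
    (h2 : ∫ z in Metric.ball (0 : Fin 3 → ℝ) 1, HH h (Φ z) ^ 2 ≤
      100 * R⁻¹ ^ 2 * ∫ y in S, HH h y ^ 2) :
    m ≤ (140 * (2 + 30 * 200 + 36 * 200 ^ 2)) * R⁻¹ * ∑ w : Fin 2 → Unit ⊕ Fin 3 ⊕ Fin 3,
      √(∫ y in S, (vf (w 0) (vf (w 1) h) y) ^ 2) := by
  have hR0 : 0 < R⁻¹ := by positivity
  have h3 := avg (fun z => HH h (Φ z)) ((HH_cont h hf).comp hΦ) m (2 + 30 * 200 + 36 * 200 ^ 2)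
    (100 * R⁻¹ ^ 2 * ∫ y in S, HH h y ^ 2) (by norm_num)
    (mul_nonneg (by positivity) (integral_nonneg fun y => sq_nonneg _)) h1 h2
  have h4 : √(100 * R⁻¹ ^ 2 * ∫ y in S, HH h y ^ 2) = 10 * R⁻¹ * √(∫ y in S, HH h y ^ 2) := by
    rw [Real.sqrt_mul (by positivity), show 100 * R⁻¹ ^ 2 = (10 * R⁻¹) ^ 2 by ring,
      Real.sqrt_sq (by positivity)]
  rw [h4] at h3
  have h5 := mul_le_mul_of_nonneg_left (sum_bound h hf S r hS) hR0.le
  linarith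

/-- Weighted Sobolev estimate on dyadic annuli:
`sup_{A_R} |h| ≤ C R⁻¹ Σ_{|μ|≤2} ‖Γ^μ h‖_{L²(Ã_R)}` uniformly in `R ≥ 1`, where `Γ` ranges
over translations and rotations, `A_R = {R < |x| < 2R}` (ball `{|x|<2}` for `R = 1`) and
`Ã_R` its enlargement. -/
theorem weighted_sobolev_annuli :
    ∃ C > 0, ∀ R : ℝ, 1 ≤ R → ∀ h : E3 → ℝ, ContDiff ℝ (⊤ : ℕ∞) h →
      ∀ x ∈ (if R = 1 then Metric.ball (0 : E3) 2
              else {y : E3 | R < ‖y‖ ∧ ‖y‖ < 2 * R}),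
        |h x| ≤ C * R⁻¹ *
          ∑ w : Fin 2 → Unit ⊕ Fin 3 ⊕ Fin 3,
            Real.sqrt (∫ y in (if R = 1 then Metric.ball (0 : E3) (17 / 4)
                else {y : E3 | 7 * R / 8 < ‖y‖ ∧ ‖y‖ < 17 * R / 8}),
              (vf (w 0) (vf (w 1) h) y) ^ 2) := by
  refine ⟨140 * (2 + 30 * 200 + 36 * 200 ^ 2), by norm_num, fun R hR h hf x hx => ?_⟩
  by_cases hR1 : R = 1
  · subst hR1
    simp only [if_true] at hx ⊢
    rw [mem_ball_zero_iff] at hx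
    refine finish h hf _ (17 / 4) Metric.ball_subset_closedBall 1 _ le_rfl
      (fun z => x + WithLp.toLp 2 z) (by fun_prop) (fun z hz => flat_curve h hf x z hz) ?_
    refine (flat_int x hx _ (HH_cont h hf)).trans ?_
    have : 0 ≤ ∫ y in Metric.ball (0 : E3) (17 / 4), HH h y ^ 2 :=
      integral_nonneg fun y => sq_nonneg _
    norm_num
    linarith
  · simp only [if_neg hR1] at hx ⊢
    obtain ⟨hx1, hx2⟩ := hx
    have hx0 : 0 < ‖x‖ := by linarith
    have hn : ‖(EuclideanSpace.single 0 1 : E3)‖ = ‖(‖x‖⁻¹ • x : E3)‖ := by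
      rw [norm_smul]
      simp [hx0.ne']
    have hQ := Submodule.reflection_sub hn
    obtain ⟨Q, hQ'⟩ : ∃ Q : E3 ≃ₗᵢ[ℝ] E3, Q (EuclideanSpace.single 0 1) = ‖x‖⁻¹ • x := ⟨_, hQ⟩
    have hxQ : ‖x‖ • Q (EuclideanSpace.single 0 1) = x := by
      rw [hQ', smul_smul, mul_inv_cancel₀ hx0.ne', one_smul]
    refine finish h hf _ (17 * R / 8) ?_ R _ hR (fun z => Q (WithLp.toLp 2 (Psi ‖x‖ z))) ?_ ?_ ?_
    · intro y hy
      rw [mem_closedBall_zero_iff]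
      exact hy.2.le
    · exact Q.continuous.comp ((PiLp.continuous_toLp 2 _).comp (Psi_cont _))
    · intro z hz
      have := chart_curve h hf Q ‖x‖ z hz
      rwa [hxQ] at this
    · exact chart_int R ‖x‖ hR hx1 hx2 Q _ (HH_cont h hf)
end
end
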